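/- arXiv:2404.02311 — 2 statements merged into one kernel-verified Lean document; each statement's English description precedes it below -/
import Mathlib

section
/- Let D be a nontrivial 2-(p^d,k,2) design with point set V = GF(p)^d admitting a flag-transitive, point-primitive automorphism group G = T ⋊ G_0 (T the translation group of V, G_0 ≤ GL_d(p) the stabilizer of 0), with even replication number r. If d is even and r divides 4(p^{d/2}−1), then (v,k,r) is one of (25,4,16), (16,6,6), (81,6,32). -/
theorem aux_count {V : Type*} [Fintype V] [DecidableEq V] (𝓑 : Finset (Finset V)) (k r : ℕ)
    (hk : ∀ B ∈ 𝓑, B.card = k)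
    (hlam : ∀ x y : V, x ≠ y → (𝓑.filter (fun B => x ∈ B ∧ y ∈ B)).card = 2)
    (hr : ∀ x : V, (𝓑.filter (fun B => x ∈ B)).card = r) (x0 : V) :
    𝓑.card * k = Fintype.card V * r ∧ r * k = r + 2 * (Fintype.card V - 1) := by
  constructor
  · have h1 : ∑ B ∈ 𝓑, B.card = 𝓑.card * k := by
      rw [Finset.sum_congr rfl hk]; simp
    have h2 : ∑ B ∈ 𝓑, B.card = ∑ x : V, (𝓑.filter (fun B => x ∈ B)).card := by
      simp only [Finset.card_filter]
      rw [Finset.sum_comm]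
      apply Finset.sum_congr rfl
      intro B _
      simp
    rw [← h1, h2, Finset.sum_congr rfl (fun x _ => hr x)]; simp
  · have h1 : ∑ B ∈ 𝓑.filter (fun B => x0 ∈ B), B.card = r * k := by
      rw [Finset.sum_congr rfl (fun B hB => hk B (Finset.mem_filter.1 hB).1)]; simp [hr]
    have h2 : ∑ B ∈ 𝓑.filter (fun B => x0 ∈ B), B.card
        = ∑ y : V, (𝓑.filter (fun B => x0 ∈ B ∧ y ∈ B)).card := by
      simp only [Finset.card_filter]
      rw [Finset.sum_comm, Finset.sum_filter]
      apply Finset.sum_congr rfl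
      intro B _
      by_cases h : x0 ∈ B <;> simp [h]
    rw [← h1, h2, ← Finset.add_sum_erase _ _ (Finset.mem_univ x0)]
    congr 1
    · simp [hr]
    · rw [Finset.sum_congr rfl (fun y hy => hlam x0 y (Finset.ne_of_mem_erase hy).symm)]
      simp [Finset.card_erase_of_mem, mul_comm]

set_option maxHeartbeats 1000000 in
theorem aux_fisher {V : Type*} [Fintype V] [DecidableEq V] (𝓑 : Finset (Finset V)) (k r : ℕ)
    (hk : ∀ B ∈ 𝓑, B.card = k)
    (hlam : ∀ x y : V, x ≠ y → (𝓑.filter (fun B => x ∈ B ∧ y ∈ B)).card = 2)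
    (hr : ∀ x : V, (𝓑.filter (fun B => x ∈ B)).card = r) (hk2 : 2 < k)
    (hkv : k < Fintype.card V) : k ≤ r := by
  have hV : 0 < Fintype.card V := by omega
  obtain ⟨x0⟩ := Fintype.card_pos_iff.1 hV
  obtain ⟨c1, c2⟩ := aux_count 𝓑 k r hk hlam hr x0
  have hr2 : 2 < r := by
    by_contra hcon
    have : r * k ≤ 2 * k := Nat.mul_le_mul_right _ (by omega)
    interval_cases r <;> omega
  have hne : 0 < 𝓑.card := by
    rcases Nat.eq_zero_or_pos 𝓑.card with h | h
    · rw [h] at c1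
      have : 0 < Fintype.card V * r := by positivity
      omega
    · exact h
  obtain ⟨B0, hB0⟩ := Finset.card_pos.1 hne
  have s1 : ∑ C ∈ 𝓑, (B0.filter (fun y => y ∈ C)).card = k * r := by
    simp only [Finset.card_filter]
    rw [Finset.sum_comm]
    rw [Finset.sum_congr rfl (fun y _ => by rw [← Finset.card_filter, hr y])]
    simp [hk B0 hB0]
  have s2 : ∑ C ∈ 𝓑, (B0.filter (fun y => y ∈ C)).card ^ 2 = k * (r + (k - 1) * 2) := by
    have : ∀ C ∈ 𝓑, (B0.filter (fun y => y ∈ C)).card ^ 2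
        = ∑ y ∈ B0, ∑ z ∈ B0, if (y ∈ C ∧ z ∈ C) then 1 else 0 := by
      intro C _
      rw [sq, Finset.card_filter, Finset.sum_mul_sum]
      apply Finset.sum_congr rfl; intro y _
      apply Finset.sum_congr rfl; intro z _
      by_cases h1 : y ∈ C <;> by_cases h2 : z ∈ C <;> simp [h1, h2]
    rw [Finset.sum_congr rfl this, Finset.sum_comm]
    have h3 : ∀ y ∈ B0, ∑ C ∈ 𝓑, ∑ z ∈ B0, (if (y ∈ C ∧ z ∈ C) then 1 else 0) = r + (k-1)*2 := by
      intro y hy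
      rw [Finset.sum_comm, ← Finset.add_sum_erase _ _ hy]
      congr 1
      · simp [hr]
      · rw [Finset.sum_congr rfl (fun z hz => by
          rw [← Finset.card_filter, hlam y z (Finset.ne_of_mem_erase hz).symm])]
        simp [Finset.card_erase_of_mem hy, hk B0 hB0]
    rw [Finset.sum_congr rfl h3]; simp [hk B0 hB0]
  rw [← Finset.add_sum_erase _ _ hB0] at s1 s2
  have hself : (B0.filter (fun y => y ∈ B0)).card = k := by
    rw [Finset.filter_true_of_mem (fun _ h => h), hk B0 hB0]
  rw [hself] at s1 s2
  have cs := sq_sum_le_card_mul_sum_sq (s := 𝓑.erase B0)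
    (f := fun C => ((B0.filter (fun y => y ∈ C)).card : ℤ))
  rw [Finset.card_erase_of_mem hB0] at cs
  set S1 := ∑ C ∈ 𝓑.erase B0, (B0.filter (fun y => y ∈ C)).card with hS1
  set S2 := ∑ C ∈ 𝓑.erase B0, (B0.filter (fun y => y ∈ C)).card ^ 2 with hS2
  have e1 : (∑ C ∈ 𝓑.erase B0, ((B0.filter (fun y => y ∈ C)).card : ℤ)) = (S1:ℤ) := by
    rw [hS1]; push_cast; rfl
  have e2 : (∑ C ∈ 𝓑.erase B0, ((B0.filter (fun y => y ∈ C)).card : ℤ) ^ 2) = (S2:ℤ) := by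
    rw [hS2]; push_cast; rfl
  rw [e1, e2] at cs
  generalize S1 = S1 at *
  generalize S2 = S2 at *
  generalize 𝓑.card = b at *
  generalize Fintype.card V = v at *
  obtain ⟨b, rfl⟩ : ∃ b', b = b' + 1 := ⟨b-1, by omega⟩
  obtain ⟨v, rfl⟩ : ∃ b', v = b' + 1 := ⟨v-1, by omega⟩
  obtain ⟨K, rfl⟩ : ∃ b', k = b' + 1 := ⟨k-1, by omega⟩
  simp only [Nat.add_sub_cancel] at *
  zify at s1 s2 c1 c2 hr2 hk2 
  by_contra hcon
  push Not at hcon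
  zify at hcon
  have f1 : (S1:ℤ) = (K+1)*(r-1) := by linarith
  have f2 : (S2:ℤ) = (K+1)*(r+K-1) := by linarith
  rw [f1, f2] at cs
  have f3 : (2*(K+1)*b:ℤ) = r^2*K + 2*r - 2*(K+1) := by nlinarith
  have f4 : 2*(K+1:ℤ)*((K+1)*(r-1))^2 ≤ (r^2*K + 2*r - 2*(K+1)) * ((K+1)*(r+K-1)) := by
    rw [← f3]; nlinarith
  have f5 : (r^2*K + 2*r - 2*(K+1)) * ((K+1)*(r+K-1)) - 2*(K+1:ℤ)*((K+1)*(r-1))^2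
      = (K+1) * (K * (r-2)^2 * (r - (K+1))) := by ring
  have f6 : (0:ℤ) < (K+1) * (K * (r-2)^2 * ((K+1) - r)) := by
    have : (0:ℤ) < r - 2 := by linarith
    have : (0:ℤ) < K := by linarith
    have : (0:ℤ) < (K+1) - r := by linarith
    positivity
  linarith

theorem aux_two_primes {p e a b : ℕ} (hp : p.Prime) (ha : a.Prime) (hb : b.Prime)
    (h1 : a ∣ p ^ e) (h2 : b ∣ p ^ e) : a = b := by
  have := (Nat.prime_dvd_prime_iff_eq ha hp).1 (ha.dvd_of_dvd_pow h1)
  have := (Nat.prime_dvd_prime_iff_eq hb hp).1 (hb.dvd_of_dvd_pow h2)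
  omega

theorem aux_params (p e k r b : ℕ) (hp : p.Prime) (hk2 : 2 < k) (hkv : k < p ^ (2*e))
    (hkr : k ≤ r) (h1 : b * k = p ^ (2 * e) * r) (h2 : r * k = r + 2 * (p ^ (2*e) - 1))
    (hdiv : r ∣ 4 * (p ^ e - 1)) :
    (p ^ (2*e) = 25 ∧ k = 4 ∧ r = 16) ∨ (p ^ (2*e) = 16 ∧ k = 6 ∧ r = 6) ∨
    (p ^ (2*e) = 81 ∧ k = 6 ∧ r = 32) ∨ (p = 3 ∧ e = 1 ∧ k = 3 ∧ r = 8) ∨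
    (p = 13 ∧ e = 1 ∧ k = 8 ∧ r = 48) ∨ (p = 29 ∧ e = 1 ∧ k = 16 ∧ r = 112) := by
  have hq2 : p ^ (2*e) = (p^e)^2 := by rw [mul_comm, pow_mul]
  rw [hq2] at hkv h1 h2 ⊢
  clear hq2
  have hpp := fun (a b : ℕ) (ha : a.Prime) (hb : b.Prime) => aux_two_primes (e := e) hp ha hb
  have hpw : ∀ n : ℕ, n.Prime → p ^ e = n → p = n ∧ e = 1 := fun n hn h =>
    (Nat.Prime.pow_eq_iff hn).1 h
  generalize p ^ e = q at *
  have hq : 2 ≤ q := by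
    by_contra h
    interval_cases q <;> omega
  obtain ⟨a, ha⟩ := hdiv
  obtain ⟨Q, rfl⟩ : ∃ Q, q = Q + 1 := ⟨q-1, by omega⟩
  obtain ⟨K, rfl⟩ : ∃ Q, k = Q + 1 := ⟨k-1, by omega⟩
  have hQ : 0 < Q := by omega
  simp only [Nat.add_sub_cancel] at ha
  have h2' : r * K = 2 * (Q * (Q + 2)) := by
    have : (Q+1)^2 - 1 = Q * (Q+2) := by
      have : (Q+1)^2 = Q * (Q+2) + 1 := by ring
      omega
    rw [this] at h2
    nlinarith
  have h3 : 2 * K = a * (Q + 2) := by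
    have : (2 * Q) * (2 * K) = (2 * Q) * (a * (Q+2)) := by
      calc (2 * Q) * (2 * K) = (4 * Q) * K := by ring
        _ = a * (r * K) := by rw [ha]; ring
        _ = _ := by rw [h2']; ring
    exact Nat.eq_of_mul_eq_mul_left (by omega) this
  have ha3 : a < 3 := by
    by_contra hcon
    push Not at hcon
    have g1 : 8 * Q ≥ a * (a * (Q+2) + 2) := by
      rw [← h3]; nlinarith
    have g2 : a * (a * (Q+2) + 2) ≥ 3 * (3 * (Q+2) + 2) := by gcongr
    omega
  have ha0 : a ≠ 0 := by rintro rfl; omega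
  have hbz : (b:ℤ) * (K+1) = (Q+1)^2 * r := by exact_mod_cast h1
  obtain rfl | rfl : a = 1 ∨ a = 2 := by omega
  · -- q + 3 divides 288
    have hr : r = 4 * Q := by omega
    subst hr
    have hdv : (Q + 4) ∣ 288 := by
      have hz : ((Q + 4 : ℕ) : ℤ) ∣ ((288:ℕ):ℤ) := by
        have hK : (2 * (K:ℤ)) = Q + 2 := by exact_mod_cast (by omega : 2 * K = Q + 2)
        refine ⟨8 * (Q:ℤ)^2 - 16 * Q + 72 - b, ?_⟩
        push_cast at *
        have : (b:ℤ) * (Q + 4) = 8 * (Q + 1)^2 * Q := by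
          have : (Q:ℤ) + 4 = 2 * (K + 1) := by linarith
          rw [this]; linarith
        linear_combination this
      exact_mod_cast hz
    have hmem : (Q + 4) ∈ Nat.divisors 288 := by simp [hdv]
    have hd : Nat.divisors 288 = {1,2,3,4,6,8,9,12,16,18,24,32,36,48,72,96,144,288} := by
      decide +kernel
    rw [hd] at hmem
    simp only [Finset.mem_insert, Finset.mem_singleton] at hmem
    rcases hmem with h|h|h|h|h|h|h|h|h|h|h|h|h|h|h|h|h|h
    · omega
    · omega
    · omega
    · omega
    · obtain rfl : Q = 2 := by omega
      obtain ⟨rfl, rfl⟩ := hpw 3 (by norm_num) rfl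
      right; right; right; left; omega
    · obtain rfl : Q = 4 := by omega
      left; omega
    · obtain rfl : Q = 5 := by omega
      have := hpp 2 3 (by norm_num) (by norm_num) (by norm_num) (by norm_num)
      omega
    · obtain rfl : Q = 8 := by omega
      right; right; left; omega
    · obtain rfl : Q = 12 := by omega
      obtain ⟨rfl, rfl⟩ := hpw 13 (by norm_num) rfl
      right; right; right; right; left; omega
    · obtain rfl : Q = 14 := by omega
      have := hpp 3 5 (by norm_num) (by norm_num) (by norm_num) (by norm_num)
      omega
    · obtain rfl : Q = 20 := by omega
      have := hpp 3 7 (by norm_num) (by norm_num) (by norm_num) (by norm_num)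
      omega
    · obtain rfl : Q = 28 := by omega
      obtain ⟨rfl, rfl⟩ := hpw 29 (by norm_num) rfl
      right; right; right; right; right; omega
    · obtain rfl : Q = 32 := by omega
      have := hpp 3 11 (by norm_num) (by norm_num) (by norm_num) (by norm_num)
      omega
    · obtain rfl : Q = 44 := by omega
      have := hpp 3 5 (by norm_num) (by norm_num) (by norm_num) (by norm_num)
      omega
    · obtain rfl : Q = 68 := by omega
      have := hpp 3 23 (by norm_num) (by norm_num) (by norm_num) (by norm_num)
      omega
    · obtain rfl : Q = 92 := by omega
      have := hpp 3 31 (by norm_num) (by norm_num) (by norm_num) (by norm_num)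
      omega
    · obtain rfl : Q = 140 := by omega
      have := hpp 3 47 (by norm_num) (by norm_num) (by norm_num) (by norm_num)
      omega
    · obtain rfl : Q = 284 := by omega
      have := hpp 3 5 (by norm_num) (by norm_num) (by norm_num) (by norm_num)
      omega
  · have hr : r = 2 * Q := by omega
    subst hr
    have hK : K = Q + 2 := by omega
    subst hK
    have hdv : (Q + 3) ∣ 24 := by
      have hz : ((Q + 3 : ℕ) : ℤ) ∣ ((24:ℕ):ℤ) := by
        refine ⟨2 * (Q:ℤ)^2 - 2 * Q + 8 - b, ?_⟩
        push_cast at *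
        linear_combination hbz
      exact_mod_cast hz
    have hmem : (Q + 3) ∈ Nat.divisors 24 := by simp [hdv]
    have hd : Nat.divisors 24 = {1,2,3,4,6,8,12,24} := by
      decide +kernel
    rw [hd] at hmem
    simp only [Finset.mem_insert, Finset.mem_singleton] at hmem
    rcases hmem with h|h|h|h|h|h|h|h
    · omega
    · omega
    · omega
    · obtain rfl : Q = 1 := by omega
      omega
    · obtain rfl : Q = 3 := by omega
      right; left; omega
    · obtain rfl : Q = 5 := by omega
      have := hpp 2 3 (by norm_num) (by norm_num) (by norm_num) (by norm_num)
      omega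
    · obtain rfl : Q = 9 := by omega
      have := hpp 2 5 (by norm_num) (by norm_num) (by norm_num) (by norm_num)
      omega
    · obtain rfl : Q = 21 := by omega
      have := hpp 2 11 (by norm_num) (by norm_num) (by norm_num) (by norm_num)
      omega

set_option synthInstance.maxSize 1000 in
set_option synthInstance.maxHeartbeats 400000 in
theorem aux_three_span : ∀ x y : Fin 2 → ZMod 3, x ≠ 0 → y ≠ 0 → y ≠ x → y ≠ -x →
    ∀ w : Fin 2 → ZMod 3, ∃ ab : ZMod 3 × ZMod 3, w = ab.1 • x + ab.2 • y := by
  decide +kernel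

theorem aux_three_fix : ∀ x y : Fin 2 → ZMod 3, x ≠ 0 → y ≠ 0 → y ≠ x → y ≠ -x →
    ∀ a b : ZMod 3, (a • (y - x) + b • (-x) = a • x + b • y ∨
      a • (-x - (y - x)) + b • (-(y - x)) = a • x + b • y) →
      (a • x + b • y = 0 ∨ a • x + b • y = x + y ∨ a • x + b • y = -(x + y)) := by
  decide +kernel

theorem aux_three (𝓑 : Finset (Finset (Fin 2 → ZMod 3)))
    (G₀ : Subgroup ((Fin 2 → ZMod 3) ≃ₗ[ZMod 3] (Fin 2 → ZMod 3)))
    (hk : ∀ B ∈ 𝓑, B.card = 3)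
    (hlam : ∀ x y : Fin 2 → ZMod 3, x ≠ y →
      (𝓑.filter (fun B => x ∈ B ∧ y ∈ B)).card = 2)
    (hinv : ∀ B ∈ 𝓑, ∀ g ∈ G₀, ∀ v : Fin 2 → ZMod 3,
      B.image (fun x => g x + v) ∈ 𝓑)
    (hflag : ∀ B ∈ 𝓑, ∀ C ∈ 𝓑, ∀ x ∈ B, ∀ y ∈ C,
      ∃ g ∈ G₀, ∃ v : Fin 2 → ZMod 3,
        B.image (fun z => g z + v) = C ∧ g x + v = y) : False := by
  -- two blocks through 0 and u, in the form {0,u,w}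
  have two : ∀ u : Fin 2 → ZMod 3, u ≠ 0 → ∃ w1 w2, w1 ≠ w2 ∧ w1 ≠ 0 ∧ w1 ≠ u ∧ w2 ≠ 0 ∧ w2 ≠ u ∧
      ∀ w, (w = w1 ∨ w = w2) ↔ (w ≠ 0 ∧ w ≠ u ∧ ({0, u, w} : Finset _) ∈ 𝓑) := by
    intro u hu
    obtain ⟨C1, C2, hne, hC⟩ := Finset.card_eq_two.1 (hlam 0 u hu.symm)
    have form : ∀ C ∈ 𝓑, 0 ∈ C → u ∈ C → ∃ w, w ≠ 0 ∧ w ≠ u ∧ C = {0, u, w} := by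
      intro C hCB h0 h1
      have : ((C.erase 0).erase u).card = 1 := by
        rw [Finset.card_erase_of_mem (Finset.mem_erase.2 ⟨hu, h1⟩), Finset.card_erase_of_mem h0,
          hk C hCB]
      obtain ⟨w, hw⟩ := Finset.card_eq_one.1 this
      have hw' : w ∈ (C.erase 0).erase u := by rw [hw]; simp
      simp only [Finset.mem_erase] at hw'
      refine ⟨w, hw'.2.1, hw'.1, ?_⟩
      rw [← hw, Finset.insert_erase (Finset.mem_erase.2 ⟨hu, h1⟩), Finset.insert_erase h0]
    have m1 : C1 ∈ 𝓑.filter (fun B => 0 ∈ B ∧ u ∈ B) := by rw [hC]; simp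
    have m2 : C2 ∈ 𝓑.filter (fun B => 0 ∈ B ∧ u ∈ B) := by rw [hC]; simp
    rw [Finset.mem_filter] at m1 m2
    obtain ⟨w1, a1, a2, a3⟩ := form C1 m1.1 m1.2.1 m1.2.2
    obtain ⟨w2, b1, b2, b3⟩ := form C2 m2.1 m2.2.1 m2.2.2
    refine ⟨w1, w2, ?_, a1, a2, b1, b2, ?_⟩
    · rintro rfl; exact hne (a3.trans b3.symm)
    · intro w
      constructor
      · rintro (rfl | rfl)
        · exact ⟨a1, a2, a3 ▸ m1.1⟩
        · exact ⟨b1, b2, b3 ▸ m2.1⟩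
      · rintro ⟨h1, h2, h3⟩
        have : ({0, u, w} : Finset _) ∈ 𝓑.filter (fun B => 0 ∈ B ∧ u ∈ B) := by
          simp [h3]
        rw [hC] at this
        simp only [Finset.mem_insert, Finset.mem_singleton] at this
        rcases this with h | h
        · left
          have : w ∈ C1 := by rw [← h]; simp
          rw [a3] at this
          simpa [h1, h2] using this
        · right
          have : w ∈ C2 := by rw [← h]; simp
          rw [b3] at this
          simpa [h1, h2] using this
  -- no block is a line through 0
  have noline : ∀ u : Fin 2 → ZMod 3, u ≠ 0 → ({0, u, -u} : Finset _) ∉ 𝓑 := by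
    intro u hu hmem
    obtain ⟨w1, w2, hne, h1, h2, h3, h4, hw⟩ := two u hu
    have key : ∀ w, w ≠ 0 → w ≠ u → ({0, u, w} : Finset _) ∈ 𝓑 → w = -u := by
      intro w hw0 hwu hwB
      obtain ⟨g, hg, v, hgB, hgv⟩ := hflag _ hmem _ hwB 0 (by simp) 0 (by simp)
      have hv : v = 0 := by simpa using hgv
      subst hv
      simp only [add_zero, Finset.image_insert, Finset.image_singleton, map_zero, map_neg] at hgB
      have e1 : u ∈ ({0, g u, -g u} : Finset _) := by rw [hgB]; simp
      have e2 : w ∈ ({0, g u, -g u} : Finset _) := by rw [hgB]; simp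
      simp only [Finset.mem_insert, Finset.mem_singleton, hu, hw0, false_or] at e1 e2
      rcases e1 with e1 | e1 <;> rcases e2 with e2 | e2
      · exact absurd (e2.trans e1.symm) hwu
      · rw [e2, ← e1]
      · have := congrArg Neg.neg e1
        rw [neg_neg] at this
        exact e2.trans this.symm
      · exact absurd (e2.trans e1.symm) hwu
    have k1 := (hw w1).1 (Or.inl rfl)
    have k2 := (hw w2).1 (Or.inr rfl)
    exact hne ((key w1 k1.1 k1.2.1 k1.2.2).trans (key w2 k2.1 k2.2.1 k2.2.2).symm)
  -- a block through 0
  obtain ⟨x, hx⟩ : ∃ x : Fin 2 → ZMod 3, x ≠ 0 := ⟨1, by decide⟩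
  obtain ⟨y, y2, -, hy0, hyx, -, -, hw⟩ := two x hx
  have hB := ((hw y).1 (Or.inl rfl)).2.2
  have hyn : y ≠ -x := by
    rintro rfl
    exact noline x hx hB
  have stab : ∀ z ∈ ({0, x, y} : Finset (Fin 2 → ZMod 3)), ∃ g ∈ G₀,
      (({0, x, y} : Finset (Fin 2 → ZMod 3)).image (fun t => g t + z) = {0, x, y}) := by
    intro z hz
    obtain ⟨g, hg, v, h1, h2⟩ := hflag _ hB _ hB 0 (by simp) z hz
    have : v = z := by simpa using h2
    subst this
    exact ⟨g, hg, h1⟩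
  have gam : ∃ g ∈ G₀, g x = y - x ∧ g y = -x := by
    obtain ⟨g, hg, h1⟩ := stab x (by simp)
    obtain ⟨g', hg', h1'⟩ := stab y (by simp)
    have mem : ∀ (z : Fin 2 → ZMod 3) (g : (Fin 2 → ZMod 3) ≃ₗ[ZMod 3] (Fin 2 → ZMod 3)),
      (({0, x, y} : Finset (Fin 2 → ZMod 3)).image (fun t => g t + z) = {0, x, y}) →
      ∀ t ∈ ({0, x, y} : Finset (Fin 2 → ZMod 3)), g t + z = 0 ∨ g t + z = x ∨ g t + z = y := by
      intro z g h t ht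
      have := Finset.mem_image_of_mem (fun t => g t + z) ht
      rw [h] at this
      simpa using this
    have a1 := mem x g h1 x (by simp)
    have a2 := mem x g h1 y (by simp)
    have b1 := mem y g' h1' x (by simp)
    have b2 := mem y g' h1' y (by simp)
    have gx : g x ≠ 0 := by simpa using hx
    have gy : g y ≠ 0 := by simpa using hy0
    have gx' : g' x ≠ 0 := by simpa using hx
    have gy' : g' y ≠ 0 := by simpa using hy0
    have gxy : g x ≠ g y := fun h => hyx (g.injective h).symm
    have gxy' : g' x ≠ g' y := fun h => hyx (g'.injective h).symm
    have a1' : g x = -x ∨ g x = y - x := by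
      rcases a1 with h | h | h
      · left; exact eq_neg_of_add_eq_zero_left h
      · exact absurd (by simpa using h) gx
      · right; exact eq_sub_of_add_eq h
    have a2' : g y = -x ∨ g y = y - x := by
      rcases a2 with h | h | h
      · left; exact eq_neg_of_add_eq_zero_left h
      · exact absurd (by simpa using h) gy
      · right; exact eq_sub_of_add_eq h
    have b1' : g' x = -y ∨ g' x = x - y := by
      rcases b1 with h | h | h
      · left; exact eq_neg_of_add_eq_zero_left h
      · right; exact eq_sub_of_add_eq h
      · exact absurd (by simpa using h) gx'
    have b2' : g' y = -y ∨ g' y = x - y := by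
      rcases b2 with h | h | h
      · left; exact eq_neg_of_add_eq_zero_left h
      · right; exact eq_sub_of_add_eq h
      · exact absurd (by simpa using h) gy'
    have done : ∀ f ∈ G₀, f x = -y → f y = x - y → ∃ g ∈ G₀, g x = y - x ∧ g y = -x := by
      intro f hf h1 h2
      refine ⟨f * f, G₀.mul_mem hf hf, ?_, ?_⟩
      · rw [LinearEquiv.mul_apply, h1, map_neg, h2]; abel
      · rw [LinearEquiv.mul_apply, h2, map_sub, h1, h2]; abel
    rcases a1' with h | h
    · have h2 : g y = y - x := by
        rcases a2' with h' | h'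
        · exact absurd (h.trans h'.symm) gxy
        · exact h'
      rcases b1' with k | k
      · have k2 : g' y = x - y := by
          rcases b2' with h' | h'
          · exact absurd (k.trans h'.symm) gxy'
          · exact h'
        exact done g' hg' k k2
      · have k2 : g' y = - y := by
          rcases b2' with h' | h'
          · exact h'
          · exact absurd (k.trans h'.symm) gxy'
        apply done (g * g') (G₀.mul_mem hg hg')
        · rw [LinearEquiv.mul_apply, k, map_sub, h, h2]; abel
        · rw [LinearEquiv.mul_apply, k2, map_neg, h2]; abel
    · refine ⟨g, hg, h, ?_⟩
      rcases a2' with h' | h'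
      · exact h'
      · exact absurd (h.trans h'.symm) gxy
  obtain ⟨g, hg, gx, gy⟩ := gam
  have gu : g (x + y) = x + y := by
    rw [map_add, gx, gy]
    have : ∀ x y : Fin 2 → ZMod 3, y - x + -x = x + y := by decide +kernel
    exact this x y
  have hu : x + y ≠ 0 := by
    intro h; exact hyn (eq_neg_of_add_eq_zero_right h)
  obtain ⟨w1, w2, hne, c1, c2, c3, c4, hw'⟩ := two (x + y) hu
  have gmap : ∀ w, (w = w1 ∨ w = w2) → (g w = w1 ∨ g w = w2) := by
    intro w h
    obtain ⟨d1, d2, d3⟩ := (hw' w).1 h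
    rw [hw']
    refine ⟨by simpa using d1, fun h => d2 (g.injective (h.trans gu.symm)), ?_⟩
    have := hinv _ d3 g hg 0
    simpa [Finset.image_insert, gu] using this
  have hcyc : g w1 = w1 ∨ g (g w1) = w1 := by
    rcases gmap w1 (Or.inl rfl) with h | h
    · exact Or.inl h
    · right
      rw [h]
      rcases gmap w2 (Or.inr rfl) with h' | h'
      · exact h'
      · exact absurd (g.injective (h.trans h'.symm)) hne
  obtain ⟨⟨a, b⟩, hab⟩ := aux_three_span x y hx hy0 hyx hyn w1
  have hfix := aux_three_fix x y hx hy0 hyx hyn a b (by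
    rw [hab] at hcyc
    simpa only [map_add, map_smul, gx, gy, map_sub, map_neg] using hcyc)
  rw [← hab] at hfix
  rcases hfix with h | h | h
  · exact c1 h
  · exact c2 h
  · apply noline (x + y) hu
    rw [← h]
    exact ((hw' w1).1 (Or.inl rfl)).2.2

open scoped Pointwise in
theorem aux_sylow {Γ : Type*} [Group Γ] [Finite Γ] (n : ℕ) (hn : Odd n)
    (hcard : Nat.card Γ = 32 * n) (m : Γ) (hm : m ^ 8 = 1) (hc : ∀ g, g * m ^ 2 = m ^ 2 * g)
    (K : Subgroup Γ) (hK : 16 ∣ Nat.card K) : m ^ 2 ∈ K := by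
  haveI : Fact (Nat.Prime 2) := ⟨Nat.prime_two⟩
  obtain ⟨P0, hP0⟩ := Sylow.exists_subgroup_card_pow_prime (G := K) 2 (n := 4) (by simpa using hK)
  set P : Subgroup Γ := P0.map K.subtype with hPdef
  have hPK : P ≤ K := by
    rintro x ⟨y, -, rfl⟩
    exact y.2
  have hPc : Nat.card P = 2 ^ 4 := by
    rw [← hP0]
    exact Nat.card_congr (P0.equivMapOfInjective K.subtype K.subtype_injective).symm.toEquiv
  obtain ⟨S, hS⟩ := (IsPGroup.of_card hPc).exists_le_sylow
  have hz : IsPGroup 2 (Subgroup.zpowers m) := by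
    rintro ⟨x, y, rfl⟩
    refine ⟨3, ?_⟩
    ext
    simp only [Subgroup.coe_pow, Subgroup.coe_one]
    rw [← zpow_natCast, zpow_comm, zpow_natCast]
    norm_num [hm]
  obtain ⟨Q, hQ⟩ := hz.exists_le_sylow
  have hSc : Nat.card S = 32 := by
    rw [Sylow.card_eq_multiplicity, hcard, Nat.factorization_mul (by norm_num) (by rintro rfl; simp at hn)]
    have h1 : (32 : ℕ).factorization 2 = 5 := by
      rw [show 32 = 2 ^ 5 by norm_num, Nat.Prime.factorization_pow Nat.prime_two]; simp
    have h2 : n.factorization 2 = 0 := Nat.factorization_eq_zero_of_not_dvd (by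
      rwa [← even_iff_two_dvd, Nat.not_even_iff_odd])
    simp [h1, h2]
  obtain ⟨c, hcS⟩ := MulAction.exists_smul_eq Γ Q S
  have hmem : c * m * c⁻¹ ∈ S := by
    rw [← hcS]
    have : m ∈ Q := hQ (Subgroup.mem_zpowers m)
    have h := Subgroup.smul_mem_pointwise_smul m (MulAut.conj c) (Q : Subgroup Γ) this
    have h' : c * m * c⁻¹ ∈ MulAut.conj c • (Q : Subgroup Γ) := by simpa [MulAut.smul_def] using h
    exact h'
  have hidx : (P.subgroupOf S).index = 2 := by
    have h := Subgroup.card_mul_index (P.subgroupOf (S : Subgroup Γ))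
    have h1 : Nat.card (P.subgroupOf (S : Subgroup Γ)) = 16 := by
      rw [Nat.card_congr (Subgroup.subgroupOfEquivOfLe hS).toEquiv, hPc]; norm_num
    rw [h1] at h
    have h2 : Nat.card (S : Subgroup Γ) = 32 := hSc
    rw [h2] at h
    omega
  have hsq := Subgroup.sq_mem_of_index_two hidx ⟨_, hmem⟩
  rw [Subgroup.mem_subgroupOf] at hsq
  have e : (c * m * c⁻¹) ^ 2 = m ^ 2 := by
    rw [conj_pow, hc, mul_assoc, mul_inv_cancel, mul_one]
  simp only [Subgroup.coe_pow] at hsq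
  rw [e] at hsq
  exact hPK hsq

def swapEquiv {F : Type*} [Field F] (i : F) (hi : i * i = -1) :
    (Fin 2 → F) ≃ₗ[F] (Fin 2 → F) where
  toFun x := ![i * x 1, x 0]
  invFun x := ![x 1, -i * x 0]
  map_add' x y := by ext j; fin_cases j <;> simp [mul_add]
  map_smul' a x := by ext j; fin_cases j <;> simp <;> ring
  left_inv x := by
    ext j; fin_cases j
    · simp
    · simp only [Fin.mk_one, Matrix.cons_val_one, Matrix.cons_val_zero]
      linear_combination (-x 1) * hi
  right_inv x := by
    ext j; fin_cases j
    · simp only [Fin.zero_eta, Matrix.cons_val_one, Matrix.cons_val_zero]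
      linear_combination (-x 0) * hi
    · simp

theorem swapEquiv_sq {F : Type*} [Field F] (i : F) (hi : i * i = -1) (x : Fin 2 → F) :
    (swapEquiv i hi ^ 2) x = i • x := by
  rw [pow_two, LinearEquiv.mul_apply]
  ext j; fin_cases j <;> simp [swapEquiv]

theorem card_lin (p : ℕ) [Fact p.Prime] :
    Nat.card ((Fin 2 → ZMod p) ≃ₗ[ZMod p] (Fin 2 → ZMod p)) = (p ^ 2 - 1) * (p ^ 2 - p) := by
  rw [← Nat.card_congr ((Matrix.GeneralLinearGroup.toLin (n := Fin 2) (R := ZMod p)).trans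
    (LinearMap.GeneralLinearGroup.generalLinearEquiv _ _)).toEquiv, Matrix.card_GL_field]
  simp [Fin.prod_univ_two]

theorem aux_scalar (p : ℕ) [Fact p.Prime] (hp : p = 13 ∨ p = 29) (i : ZMod p) (hi : i * i = -1)
    (K : Subgroup ((Fin 2 → ZMod p) ≃ₗ[ZMod p] (Fin 2 → ZMod p))) (hK : 16 ∣ Nat.card K) :
    ∃ g ∈ K, ∀ x, g x = i • x := by
  refine ⟨swapEquiv i hi ^ 2, ?_, swapEquiv_sq i hi⟩
  have hc : ∃ n, Odd n ∧ Nat.card ((Fin 2 → ZMod p) ≃ₗ[ZMod p] (Fin 2 → ZMod p)) = 32 * n := by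
    rw [card_lin]
    rcases hp with rfl | rfl
    · exact ⟨819, by decide, by norm_num⟩
    · exact ⟨21315, by decide, by norm_num⟩
  obtain ⟨n, hn, hcard⟩ := hc
  haveI : Finite ((Fin 2 → ZMod p) ≃ₗ[ZMod p] (Fin 2 → ZMod p)) := by
    apply Nat.finite_of_card_ne_zero
    rw [hcard]
    rintro h
    have : n = 0 := by omega
    subst this
    simp at hn
  apply aux_sylow n hn hcard _ _ _ K hK
  · rw [show 8 = 2 * 4 by norm_num, pow_mul]
    ext1 x
    simp only [pow_succ, pow_zero, one_mul, LinearEquiv.mul_apply]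
    simp only [← LinearEquiv.mul_apply (swapEquiv i hi), ← pow_two, swapEquiv_sq, smul_smul]
    have h4 : i * (i * i ^ 2) = 1 := by linear_combination (i * i - 1) * hi
    rw [h4]; simp
  · intro g
    ext1 x
    simp only [LinearEquiv.mul_apply, swapEquiv_sq, map_smul]
structure Dsn (p k : ℕ) (𝓑 : Finset (Finset (Fin 2 → ZMod p)))
    (G₀ : Subgroup ((Fin 2 → ZMod p) ≃ₗ[ZMod p] (Fin 2 → ZMod p))) : Prop where
  hk : ∀ B ∈ 𝓑, B.card = k
  hlam : ∀ x y : Fin 2 → ZMod p, x ≠ y →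
      (𝓑.filter (fun B => x ∈ B ∧ y ∈ B)).card = 2
  hinv : ∀ B ∈ 𝓑, ∀ g ∈ G₀, ∀ v : Fin 2 → ZMod p,
      B.image (fun x => g x + v) ∈ 𝓑
  hflag : ∀ B ∈ 𝓑, ∀ C ∈ 𝓑, ∀ x ∈ B, ∀ y ∈ C,
      ∃ g ∈ G₀, ∃ v : Fin 2 → ZMod p,
        B.image (fun z => g z + v) = C ∧ g x + v = y
  hkp : (k : ZMod p) ≠ 0

/-- A block with zero sum. -/
def Base {p : ℕ} (𝓑 : Finset (Finset (Fin 2 → ZMod p))) (X : Finset (Fin 2 → ZMod p)) : Prop :=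
  X ∈ 𝓑 ∧ ∑ x ∈ X, x = 0

section
variable {p k : ℕ} [Fact p.Prime] {𝓑 : Finset (Finset (Fin 2 → ZMod p))}
    {G₀ : Subgroup ((Fin 2 → ZMod p) ≃ₗ[ZMod p] (Fin 2 → ZMod p))}

theorem sum_image_affine (X : Finset (Fin 2 → ZMod p))
    (g : (Fin 2 → ZMod p) ≃ₗ[ZMod p] (Fin 2 → ZMod p)) (v : Fin 2 → ZMod p) :
    ∑ x ∈ X.image (fun x => g x + v), x = g (∑ x ∈ X, x) + (X.card : ZMod p) • v := by
  rw [Finset.sum_image, Finset.sum_add_distrib, map_sum, Finset.sum_const]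
  · simp [Nat.cast_smul_eq_nsmul]
  · intro a _ b _ h
    exact g.injective (add_right_cancel h)

theorem Dsn.translate (D : Dsn p k 𝓑 G₀) {B} (hB : B ∈ 𝓑) (v : Fin 2 → ZMod p) :
    B.image (fun x => x + v) ∈ 𝓑 := by
  simpa using D.hinv B hB 1 G₀.one_mem v

theorem Dsn.exists_base (D : Dsn p k 𝓑 G₀) {C} (hC : C ∈ 𝓑) :
    ∃ v : Fin 2 → ZMod p, Base 𝓑 (C.image (fun x => x + v)) := by
  refine ⟨-((k : ZMod p)⁻¹ • ∑ x ∈ C, x), D.translate hC _, ?_⟩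
  have := sum_image_affine C 1 (-((k : ZMod p)⁻¹ • ∑ x ∈ C, x))
  simp only [LinearEquiv.coe_one, id] at this
  rw [this, D.hk C hC, smul_neg, smul_smul, mul_inv_cancel₀ D.hkp, one_smul, add_neg_cancel]

theorem Dsn.base_flag (D : Dsn p k 𝓑 G₀) {X Y} (hX : Base 𝓑 X) (hY : Base 𝓑 Y) {x y}
    (hx : x ∈ X) (hy : y ∈ Y) : ∃ g ∈ G₀, X.image g = Y ∧ g x = y := by
  obtain ⟨g, hg, v, h1, h2⟩ := D.hflag X hX.1 Y hY.1 x hx y hy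
  have hs := sum_image_affine X g v
  rw [h1, hX.2, hY.2, map_zero, zero_add, D.hk X hX.1] at hs
  have hv : v = 0 := by
    rcases smul_eq_zero.1 hs.symm with h | h
    · exact absurd h D.hkp
    · exact h
  subst hv
  exact ⟨g, hg, by simpa using h1, by simpa using h2⟩

theorem Dsn.base_image (D : Dsn p k 𝓑 G₀) {X} (hX : Base 𝓑 X) {g} (hg : g ∈ G₀) :
    Base 𝓑 (X.image g) := by
  refine ⟨by simpa using D.hinv X hX.1 g hg 0, ?_⟩
  have := sum_image_affine X g 0
  simpa [hX.2] using this

theorem Dsn.trans_eq (D : Dsn p k 𝓑 G₀) {X Y} (hX : Base 𝓑 X) (hY : Base 𝓑 Y) {a b}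
    (h : X.image (fun x => x + a) = Y.image (fun x => x + b)) : X = Y ∧ a = b := by
  have h1 := sum_image_affine X 1 a
  have h2 := sum_image_affine Y 1 b
  simp only [LinearEquiv.coe_one, id, hX.2, hY.2, D.hk X hX.1, D.hk Y hY.1, zero_add] at h1 h2
  rw [h, h2] at h1
  have hab : a = b := ((smul_right_inj D.hkp).1 h1).symm
  subst hab
  exact ⟨Finset.image_injective (add_left_injective a) h, rfl⟩

theorem Dsn.key3 (D : Dsn p k 𝓑 G₀) {X1 X2 X3} (h1 : Base 𝓑 X1) (h2 : Base 𝓑 X2)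
    (h3 : Base 𝓑 X3) {a1 b1 a2 b2 a3 b3} (ha1 : a1 ∈ X1) (hb1 : b1 ∈ X1) (ha2 : a2 ∈ X2)
    (hb2 : b2 ∈ X2) (ha3 : a3 ∈ X3) (hb3 : b3 ∈ X3) (hne : a1 ≠ b1)
    (e2 : a1 - b1 = a2 - b2) (e3 : a1 - b1 = a3 - b3) :
    (X1 = X2 ∧ b1 = b2) ∨ (X1 = X3 ∧ b1 = b3) ∨ (X2 = X3 ∧ b2 = b3) := by
  have hδ : (0 : Fin 2 → ZMod p) ≠ a1 - b1 := (sub_ne_zero.2 hne).symm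
  have mem : ∀ X, Base 𝓑 X → ∀ a ∈ X, ∀ b ∈ X, a1 - b1 = a - b →
      X.image (fun x => x + -b) ∈ 𝓑.filter (fun B => 0 ∈ B ∧ a1 - b1 ∈ B) := by
    intro X hX a ha b hb h
    rw [Finset.mem_filter]
    refine ⟨D.translate hX.1 _, ?_, ?_⟩
    · exact Finset.mem_image.2 ⟨b, hb, by simp⟩
    · exact Finset.mem_image.2 ⟨a, ha, by rw [h]; abel⟩
  obtain ⟨C1, C2, -, hC⟩ := Finset.card_eq_two.1 (D.hlam 0 _ hδ)
  have m1 := mem X1 h1 a1 ha1 b1 hb1 rfl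
  have m2 := mem X2 h2 a2 ha2 b2 hb2 e2
  have m3 := mem X3 h3 a3 ha3 b3 hb3 e3
  rw [hC, Finset.mem_insert, Finset.mem_singleton] at m1 m2 m3
  have fin : ∀ {X Y}, Base 𝓑 X → Base 𝓑 Y → ∀ {a b C}, X.image (fun x => x + -a) = C →
      Y.image (fun x => x + -b) = C → X = Y ∧ a = b := by
    intro X Y hX hY a b C e1 e2
    obtain ⟨q1, q2⟩ := D.trans_eq hX hY (e1.trans e2.symm)
    exact ⟨q1, neg_injective q2⟩
  rcases m1 with m1 | m1 <;> rcases m2 with m2 | m2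
  · exact Or.inl (fin h1 h2 m1 m2)
  · rcases m3 with m3 | m3
    · exact Or.inr (Or.inl (fin h1 h3 m1 m3))
    · exact Or.inr (Or.inr (fin h2 h3 m2 m3))
  · rcases m3 with m3 | m3
    · exact Or.inr (Or.inr (fin h2 h3 m2 m3))
    · exact Or.inr (Or.inl (fin h1 h3 m1 m3))
  · exact Or.inl (fin h1 h2 m1 m2)

/-- stabilizer of `B` in `G₀`. -/
def stabB (G₀ : Subgroup ((Fin 2 → ZMod p) ≃ₗ[ZMod p] (Fin 2 → ZMod p)))
    (B : Finset (Fin 2 → ZMod p)) :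
    Subgroup ((Fin 2 → ZMod p) ≃ₗ[ZMod p] (Fin 2 → ZMod p)) where
  carrier := {g | g ∈ G₀ ∧ B.image g = B}
  one_mem' := ⟨G₀.one_mem, by simp⟩
  mul_mem' := by
    rintro a b ⟨ha, ha'⟩ ⟨hb, hb'⟩
    refine ⟨G₀.mul_mem ha hb, ?_⟩
    have : B.image (a * b) = (B.image b).image a := by
      rw [Finset.image_image]; rfl
    rw [this, hb', ha']
  inv_mem' := by
    rintro a ⟨ha, ha'⟩
    refine ⟨G₀.inv_mem ha, ?_⟩
    conv_lhs => rw [← ha']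
    rw [Finset.image_image]
    have : (⇑a⁻¹ ∘ ⇑a) = id := by
      ext x : 1
      exact a.symm_apply_apply x
    rw [this, Finset.image_id]

theorem mem_stabB {G₀ : Subgroup ((Fin 2 → ZMod p) ≃ₗ[ZMod p] (Fin 2 → ZMod p))}
    {B : Finset (Fin 2 → ZMod p)} {g} : g ∈ stabB G₀ B ↔ g ∈ G₀ ∧ B.image g = B := Iff.rfl

theorem Dsn.card_stab (D : Dsn p k 𝓑 G₀) {B} (hB : Base 𝓑 B) {x} (hx : x ∈ B) :
    k ∣ Nat.card (stabB G₀ B) := by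
  have h : MulAction.orbit (stabB G₀ B) x = (B : Set (Fin 2 → ZMod p)) := by
    ext y
    constructor
    · rintro ⟨⟨g, hg⟩, rfl⟩
      have : g x ∈ B.image g := Finset.mem_image_of_mem _ hx
      rw [hg.2] at this
      exact this
    · intro hy
      obtain ⟨g, hg, h1, h2⟩ := D.base_flag hB hB hx hy
      exact ⟨⟨g, hg, h1⟩, h2⟩
  have h2 := MulAction.index_stabilizer (stabB G₀ B) x
  rw [h, Set.ncard_coe_finset, D.hk B hB.1] at h2
  rw [← h2]
  exact Subgroup.index_dvd_card _

open scoped Pointwise in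
theorem Dsn.card_G (D : Dsn p k 𝓑 G₀) {r : ℕ}
    (hr : (𝓑.filter (fun B => (0 : Fin 2 → ZMod p) ∈ B)).card = r) {B} (hB : B ∈ 𝓑) (h0 : 0 ∈ B) :
    r ∣ Nat.card G₀ := by
  have h : MulAction.orbit G₀ B =
      ((𝓑.filter (fun B => (0 : Fin 2 → ZMod p) ∈ B) : Finset _) : Set (Finset (Fin 2 → ZMod p))) := by
    ext C
    simp only [Finset.coe_filter, Set.mem_setOf_eq]
    constructor
    · rintro ⟨⟨g, hg⟩, rfl⟩
      have e : (⟨g, hg⟩ : G₀) • B = B.image (fun x => g x + 0) := by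
        simp only [add_zero]; rfl
      simp only [e]
      refine ⟨D.hinv B hB g hg 0, Finset.mem_image.2 ⟨0, h0, by simp⟩⟩
    · rintro ⟨hC, h0C⟩
      obtain ⟨g, hg, v, h1, h2⟩ := D.hflag B hB C hC 0 h0 0 h0C
      have hv : v = 0 := by simpa using h2
      subst hv
      refine ⟨⟨g, hg⟩, ?_⟩
      rw [← h1]
      simp only [add_zero]; rfl
  have h2 := MulAction.index_stabilizer G₀ B
  rw [h, Set.ncard_coe_finset, hr] at h2
  rw [← h2]
  exact Subgroup.index_dvd_card _

end
section
variable {p k : ℕ} [Fact p.Prime] {𝓑 : Finset (Finset (Fin 2 → ZMod p))}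
    {G₀ : Subgroup ((Fin 2 → ZMod p) ≃ₗ[ZMod p] (Fin 2 → ZMod p))}

theorem Dsn.exists_block (D : Dsn p k 𝓑 G₀) : ∃ B ∈ 𝓑, (0 : Fin 2 → ZMod p) ∈ B := by
  have h := D.hlam 0 1 zero_ne_one
  have : (𝓑.filter (fun B => (0 : Fin 2 → ZMod p) ∈ B ∧ 1 ∈ B)).Nonempty := by
    rw [← Finset.card_pos, h]; norm_num
  obtain ⟨B, hB⟩ := this
  rw [Finset.mem_filter] at hB
  exact ⟨B, hB.1, hB.2.1⟩

theorem Dsn.zero_notMem (D : Dsn p k 𝓑 G₀) (hk2 : 2 < k) {B} (hB : Base 𝓑 B) : 0 ∉ B := by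
  intro h0
  have h1 : ∃ y ∈ B, y ≠ 0 := by
    apply Finset.exists_mem_ne
    rw [D.hk B hB.1]; omega
  obtain ⟨y, hy, hy0⟩ := h1
  obtain ⟨g, -, -, h⟩ := D.base_flag hB hB h0 hy
  exact hy0 (by rw [← h, map_zero])

/-- If minus one fixes the base block `X` as a set then it fixes every base block. -/
theorem Dsn.smul_closed (D : Dsn p k 𝓑 G₀) {X Y} (hX : Base 𝓑 X) (hY : Base 𝓑 Y)
    {c : ZMod p} (h : ∀ x ∈ X, c • x ∈ X) {y} (hy : y ∈ Y) (hne : X.Nonempty) : c • y ∈ Y := by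
  obtain ⟨x, hx⟩ := hne
  obtain ⟨g, -, h1, h2⟩ := D.base_flag hX hY hx hy
  rw [← h2, ← map_smul, ← h1]
  exact Finset.mem_image_of_mem _ (h x hx)

theorem Dsn.no_i (D : Dsn p k 𝓑 G₀) (hp2 : p ≠ 2) (hk2 : 2 < k) {i : ZMod p} (hi : i * i = -1)
    (hG : ∃ g ∈ G₀, ∀ y, g y = i • y) {B} (hB : Base 𝓑 B) (hclosed : ∀ x ∈ B, i • x ∈ B) : False := by
  have two_ne : (2 : ZMod p) ≠ 0 := by
    intro h
    have : ((2 : ℕ) : ZMod p) = 0 := by exact_mod_cast h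
    rw [ZMod.natCast_eq_zero_iff, Nat.dvd_prime Nat.prime_two] at this
    rcases this with h | h
    · exact (Fact.out : p.Prime).one_lt.ne' h
    · exact hp2 h
  have hneg : ∀ {Y : Finset (Fin 2 → ZMod p)}, (∀ x ∈ Y, i • x ∈ Y) → ∀ x ∈ Y, -x ∈ Y := by
    intro Y h x hx
    have := h _ (h x hx)
    rwa [smul_smul, hi, neg_one_smul] at this
  have hne : B.Nonempty := by rw [← Finset.card_pos, D.hk B hB.1]; omega
  obtain ⟨x, hx⟩ := hne
  have hx0 : x ≠ 0 := fun h => D.zero_notMem hk2 hB (h ▸ hx)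
  have hxn : x ≠ -x := by
    intro h
    have h' : (2 : ZMod p) • x = 0 := by
      rw [two_smul]; exact add_eq_zero_iff_eq_neg.2 h
    rcases smul_eq_zero.1 h' with h | h
    · exact two_ne h
    · exact hx0 h
  have hnx := hneg hclosed x hx
  -- second block
  have hc := D.hlam x (-x) hxn
  have hBm : B ∈ 𝓑.filter (fun B => x ∈ B ∧ -x ∈ B) := by
    simp [hB.1, hx, hnx]
  obtain ⟨Y, hY, hYB⟩ := Finset.exists_mem_ne (by rw [hc]; norm_num) B
  have only : ∀ Z ∈ 𝓑, x ∈ Z → -x ∈ Z → Z = B ∨ Z = Y := by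
    intro Z hZ h1 h2
    by_contra hcon
    push Not at hcon
    have : ({Z, B, Y} : Finset _) ⊆ 𝓑.filter (fun B => x ∈ B ∧ -x ∈ B) := by
      intro W hW
      simp only [Finset.mem_insert, Finset.mem_singleton] at hW
      rcases hW with rfl | rfl | rfl
      · simp [hZ, h1, h2]
      · exact hBm
      · exact hY
    have := Finset.card_le_card this
    rw [hc, Finset.card_eq_three.2 ⟨Z, B, Y, hcon.1, hcon.2, hYB.symm, rfl⟩] at this
    omega
  rw [Finset.mem_filter] at hY
  -- minus one lies in the stabilizer of zero
  obtain ⟨g, hg, hgi⟩ := hG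
  have hgn : ∃ g ∈ G₀, ∀ y, g y = -y := by
    refine ⟨g * g, G₀.mul_mem hg hg, fun y => ?_⟩
    rw [LinearEquiv.mul_apply, hgi, hgi, smul_smul, hi, neg_one_smul]
  obtain ⟨ν, hν, hνy⟩ := hgn
  have hYn : Y.image ν = Y := by
    have h1 : Y.image ν ∈ 𝓑 := by simpa using D.hinv Y hY.1 ν hν 0
    have h2 := only _ h1 (Finset.mem_image.2 ⟨-x, hY.2.2, by simp [hνy]⟩)
      (Finset.mem_image.2 ⟨x, hY.2.1, by simp [hνy]⟩)
    rcases h2 with h | h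
    · exfalso
      apply hYB
      apply Finset.eq_of_subset_of_card_le
      · intro y hy
        have : ν y ∈ B := by rw [← h]; exact Finset.mem_image_of_mem _ hy
        rw [hνy] at this
        simpa using hneg hclosed _ this
      · rw [D.hk Y hY.1, D.hk B hB.1]
    · exact h
  have hYb : Base 𝓑 Y := by
    refine ⟨hY.1, ?_⟩
    have h1 := sum_image_affine Y ν 0
    simp only [add_zero, smul_zero] at h1
    rw [show (fun x => ν x) = ν from rfl, hYn, hνy] at h1
    have h' : (2 : ZMod p) • (∑ x ∈ Y, x) = 0 := by
      rw [two_smul]; exact add_eq_zero_iff_eq_neg.2 h1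
    rcases smul_eq_zero.1 h' with h | h
    · exact absurd h two_ne
    · exact h
  have hiY : i • x ∈ Y := D.smul_closed hB hYb hclosed hY.2.1 ⟨x, hx⟩
  have hxi : x ≠ i • x := by
    intro h
    have h2 : i • x = i • (i • x) := congrArg (fun t => i • t) h
    rw [smul_smul, hi, ← h, neg_one_smul] at h2
    exact hxn h2
  have hib := hclosed x hx
  have hnix : -(i • x) ∈ B := hneg hclosed _ hib
  rcases D.key3 hYb hB hB hY.2.1 hiY hx hib hnix hnx hxi rfl (by abel) with h | h | h
  · exact hYB h.1
  · exact hYB h.1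
  · have h2 : i • x = -x := h.2
    have h3 : i • (i • x) = i • -x := by rw [h2]
    rw [smul_smul, hi, smul_neg, h2, neg_one_smul, neg_neg] at h3
    exact hxn h3.symm

theorem Dsn.no_i_stab (D : Dsn p k 𝓑 G₀) (hp2 : p ≠ 2) (hk2 : 2 < k) {i : ZMod p}
    (hi : i * i = -1) {B} (hB : Base 𝓑 B) (hG : ∃ g ∈ stabB G₀ B, ∀ y, g y = i • y) : False := by
  obtain ⟨g, hg, h⟩ := hG
  apply D.no_i hp2 hk2 hi ⟨g, hg.1, h⟩ hB
  intro x hx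
  have := Finset.mem_image_of_mem g hx
  rwa [hg.2, h] at this
end

theorem aux_i29 : (12 : ZMod 29) * 12 = -1 := by decide

theorem aux_29 (𝓑 : Finset (Finset (Fin 2 → ZMod 29)))
    (G₀ : Subgroup ((Fin 2 → ZMod 29) ≃ₗ[ZMod 29] (Fin 2 → ZMod 29)))
    [Fact (Nat.Prime 29)] (D : Dsn 29 16 𝓑 G₀) : False := by
  obtain ⟨C, hC, -⟩ := D.exists_block
  obtain ⟨v, hB⟩ := D.exists_base hC
  set B := C.image (fun x => x + v)
  have hne : B.Nonempty := by rw [← Finset.card_pos, D.hk B hB.1]; omega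
  obtain ⟨x, hx⟩ := hne
  have hi : (12 : ZMod 29) * 12 = -1 := aux_i29
  exact D.no_i_stab (by norm_num) (by norm_num) hi hB
    (aux_scalar 29 (Or.inr rfl) 12 hi _ (D.card_stab hB hx))
/-- The properties of a base block for `p = 13` which the finite computation refutes. -/
structure S13 (B : Finset (Fin 2 → ZMod 13)) : Prop where
  card : B.card = 8
  zero : 0 ∉ B
  neg : ∀ x ∈ B, -x ∈ B
  n2 : ∀ s ∈ B, ∀ t ∈ B, ∀ s' ∈ B, ∀ t' ∈ B, s ≠ t → s ≠ -t → s - t = s' - t' → t' = t ∨ t' = -s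
  n5 : ∀ s ∈ B, ∀ t ∈ B, ∀ s' ∈ B, ∀ t' ∈ B, s ≠ t → s ≠ -t → s - t ≠ (5 : ZMod 13) • (s' - t')
  tr : ∀ x ∈ B, ∀ y ∈ B, ∃ g : (Fin 2 → ZMod 13) ≃ₗ[ZMod 13] (Fin 2 → ZMod 13),
    (∀ z ∈ B, g z ∈ B) ∧ g x = y
  cmp : ∃ g : (Fin 2 → ZMod 13) ≃ₗ[ZMod 13] (Fin 2 → ZMod 13),
    ∀ c : ZMod 13, c ^ 4 = 1 → ∀ s ∈ B, ∀ t ∈ B, ∀ s' ∈ B, ∀ t' ∈ B, s ≠ t →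
      (s ≠ -t ∨ (s' ≠ t' ∧ s' ≠ -t')) → g (s - t) ≠ c • (s' - t')

theorem aux_invol {F : Type*} [Field F] (h2 : (2 : F) ≠ 0) (g : (Fin 2 → F) ≃ₗ[F] (Fin 2 → F))
    (hg : g ^ 2 = 1) (hg1 : g ≠ 1) (hdet : LinearEquiv.det g = 1) (x : Fin 2 → F) : g x = -x := by
  set M := LinearMap.toMatrix' (g : (Fin 2 → F) →ₗ[F] (Fin 2 → F)) with hM
  have happ : ∀ y, g y = M.mulVec y := by
    intro y
    rw [hM, LinearMap.toMatrix'_mulVec]; rfl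
  have hMdet : M.det = 1 := by
    rw [hM, LinearMap.det_toMatrix']
    have := congrArg Units.val hdet
    rwa [LinearEquiv.coe_det, Units.val_one] at this
  have hMM : M * M = 1 := by
    rw [hM, ← LinearMap.toMatrix'_comp, ← LinearMap.toMatrix'_one]
    congr 1
    ext1 y
    have := congrArg (fun f : (Fin 2 → F) ≃ₗ[F] (Fin 2 → F) => f) hg
    ext j
    have h3 : (g * g) = 1 := by rw [← pow_two]; exact hg
    have h4 := congrArg (fun f : (Fin 2 → F) ≃ₗ[F] (Fin 2 → F) => f (Pi.single y 1) j) h3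
    simpa using h4
  rw [Matrix.det_fin_two] at hMdet
  have e00 := congrFun (congrFun hMM 0) 0
  have e01 := congrFun (congrFun hMM 0) 1
  have e10 := congrFun (congrFun hMM 1) 0
  have e11 := congrFun (congrFun hMM 1) 1
  simp only [Matrix.mul_apply, Fin.sum_univ_two, Matrix.one_apply_eq] at e00 e11
  simp only [Matrix.mul_apply, Fin.sum_univ_two] at e01 e10
  rw [Matrix.one_apply_ne (by decide)] at e01 e10
  have htr : M 0 0 + M 1 1 ≠ 0 := by
    intro h
    apply h2
    linear_combination (-1 : F) * hMdet - e00 + M 0 0 * h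
  have hb : M 0 1 = 0 := by
    have : M 0 1 * (M 0 0 + M 1 1) = 0 := by linear_combination e01
    exact (mul_eq_zero.1 this).resolve_right htr
  have hc : M 1 0 = 0 := by
    have : M 1 0 * (M 0 0 + M 1 1) = 0 := by linear_combination e10
    exact (mul_eq_zero.1 this).resolve_right htr
  rw [hb] at e00 hMdet
  rw [hc] at e11
  have ha : (M 0 0 - 1) * (M 0 0 + 1) = 0 := by linear_combination e00
  have had : M 0 0 = M 1 1 := by
    have : M 0 0 * (M 0 0 - M 1 1) = 0 := by linear_combination e00 - hMdet
    rcases mul_eq_zero.1 this with h | h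
    · rw [h] at e00; simp at e00
    · exact sub_eq_zero.1 h
  have hgx : ∀ y, g y = M 0 0 • y := by
    intro y
    rw [happ]
    ext j
    fin_cases j
    · simp [Matrix.mulVec, dotProduct, Fin.sum_univ_two, hb]
    · simp [Matrix.mulVec, dotProduct, Fin.sum_univ_two, hc, had]
  rcases mul_eq_zero.1 ha with h | h
  · exfalso
    apply hg1
    ext1 y
    rw [hgx, sub_eq_zero.1 h, one_smul]; rfl
  · rw [hgx, eq_neg_of_add_eq_zero_left h, neg_one_smul]

theorem aux_neg13 [Fact (Nat.Prime 13)]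
    (H : Subgroup ((Fin 2 → ZMod 13) ≃ₗ[ZMod 13] (Fin 2 → ZMod 13))) (hH : 8 ∣ Nat.card H) :
    ∃ g ∈ H, ∀ x, g x = -x := by
  let f : H →* (ZMod 13)ˣ := LinearEquiv.det.comp H.subtype
  have hfin : Finite ((Fin 2 → ZMod 13) ≃ₗ[ZMod 13] (Fin 2 → ZMod 13)) := by
    apply Nat.finite_of_card_ne_zero
    rw [card_lin]; norm_num
  have h1 : Nat.card f.ker * f.ker.index = Nat.card H := Subgroup.card_mul_index _
  have h2 : f.ker.index ∣ 12 := by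
    rw [Subgroup.index_ker]
    have h := Subgroup.card_subgroup_dvd_card f.range
    have h12 : Nat.card (ZMod 13)ˣ = 12 := by
      rw [Nat.card_eq_fintype_card, ZMod.card_units]
    rwa [h12] at h
  have h3 : 2 ∣ Nat.card f.ker := by
    have h4 : 8 ∣ Nat.card f.ker * 12 := by
      rw [← h1] at hH
      exact hH.trans (Nat.mul_dvd_mul_left _ h2)
    omega
  have : Fact (Nat.Prime 2) := ⟨Nat.prime_two⟩
  obtain ⟨g, hg⟩ := exists_prime_orderOf_dvd_card' 2 h3
  refine ⟨g.1.1, g.1.2, fun x => ?_⟩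
  have hg2 : g ^ 2 = 1 := orderOf_dvd_iff_pow_eq_one.1 hg.dvd
  have hg1 : g ≠ 1 := by
    rintro rfl
    simp at hg
  have two_ne : (2 : ZMod 13) ≠ 0 := by
    have : ((2 : ℕ) : ZMod 13) ≠ 0 := by
      rw [Ne, ZMod.natCast_eq_zero_iff]; norm_num
    exact_mod_cast this
  apply aux_invol two_ne
  · have := congrArg (fun t : f.ker => t.1.1) hg2
    simpa using this
  · intro h
    apply hg1
    exact Subtype.ext (Subtype.ext h)
  · exact g.2

theorem Dsn.k2 {p k : ℕ} [Fact p.Prime] {𝓑 : Finset (Finset (Fin 2 → ZMod p))}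
    {G₀ : Subgroup ((Fin 2 → ZMod p) ≃ₗ[ZMod p] (Fin 2 → ZMod p))} (D : Dsn p k 𝓑 G₀)
    {X Y} (hX : Base 𝓑 X) (hY : Base 𝓑 Y) (hneg : ∀ x ∈ X, -x ∈ X)
    {s t s' t'} (hs : s ∈ X) (ht : t ∈ X) (hs' : s' ∈ Y) (ht' : t' ∈ Y) (h1 : s ≠ t) (h2 : s ≠ -t)
    (h : s - t = s' - t') : X = Y ∧ (t' = t ∨ t' = -s) := by
  rcases D.key3 hX hX hY hs ht (hneg t ht) (hneg s hs) hs' ht' h1 (by abel) h with q | q | q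
  · exact absurd (by rw [q.2, neg_neg]) h2
  · exact ⟨q.1, Or.inl q.2.symm⟩
  · exact ⟨q.1, Or.inr q.2.symm⟩

theorem aux_c4 : ∀ c : ZMod 13, c ^ 4 = 1 → c = 1 ∨ c = -1 ∨ c = 5 ∨ c = -5 := by decide

theorem aux_i13 : (5 : ZMod 13) * 5 = -1 := by decide

theorem aux_S13 [Fact (Nat.Prime 13)] (𝓑 : Finset (Finset (Fin 2 → ZMod 13)))
    (G₀ : Subgroup ((Fin 2 → ZMod 13) ≃ₗ[ZMod 13] (Fin 2 → ZMod 13)))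
    (D : Dsn 13 8 𝓑 G₀)
    (hr : (𝓑.filter (fun B => (0 : Fin 2 → ZMod 13) ∈ B)).card = 48) : ∃ B, S13 B := by
  obtain ⟨C, hC, h0C⟩ := D.exists_block
  obtain ⟨v, hB⟩ := D.exists_base hC
  set B := C.image (fun x => x + v)
  have hne : B.Nonempty := by rw [← Finset.card_pos, D.hk B hB.1]; omega
  obtain ⟨ι, hι, hιx⟩ := aux_scalar 13 (Or.inl rfl) 5 aux_i13 G₀
    ((by norm_num : 16 ∣ 48).trans (D.card_G hr hC h0C))
  have hneg : ∀ {X}, Base 𝓑 X → ∀ x ∈ X, -x ∈ X := by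
    intro X hX x hx
    obtain ⟨g, hg, hgx⟩ := aux_neg13 _ (D.card_stab hX hx)
    have := Finset.mem_image_of_mem g hx
    rwa [hg.2, hgx] at this
  set I := B.image ι with hI
  have hIb : Base 𝓑 I := D.base_image hB hι
  have hBI : B ≠ I := by
    intro h
    exact D.no_i_stab (by norm_num) (by norm_num) aux_i13 hB ⟨ι, ⟨hι, h.symm⟩, hιx⟩
  have hmemI : ∀ x ∈ B, (5 : ZMod 13) • x ∈ I := by
    intro x hx
    rw [← hιx]; exact Finset.mem_image_of_mem _ hx
  have hsc : ∀ c : ZMod 13, c ^ 4 = 1 → ∃ Y, (Y = B ∨ Y = I) ∧ ∀ x ∈ B, c • x ∈ Y := by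
    intro c hc
    rcases aux_c4 c hc with rfl | rfl | rfl | rfl
    · exact ⟨B, Or.inl rfl, fun x hx => by simpa using hx⟩
    · exact ⟨B, Or.inl rfl, fun x hx => by simpa using hneg hB x hx⟩
    · exact ⟨I, Or.inr rfl, hmemI⟩
    · exact ⟨I, Or.inr rfl, fun x hx => by simpa using hmemI _ (hneg hB x hx)⟩
  refine ⟨B, D.hk B hB.1, D.zero_notMem (by norm_num) hB, hneg hB, ?_, ?_, ?_, ?_⟩
  · intro s hs t ht s' hs' t' ht' h1 h2 h
    exact (D.k2 hB hB (hneg hB) hs ht hs' ht' h1 h2 h).2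
  · intro s hs t ht s' hs' t' ht' h1 h2 h
    rw [smul_sub] at h
    exact hBI (D.k2 hB hIb (hneg hB) hs ht (hmemI s' hs') (hmemI t' ht') h1 h2 h).1
  · intro x hx y hy
    obtain ⟨g, hg, h1, h2⟩ := D.base_flag hB hB hx hy
    refine ⟨g, fun z hz => ?_, h2⟩
    rw [← h1]; exact Finset.mem_image_of_mem _ hz
  · have hX : ∃ X, Base 𝓑 X ∧ X ≠ B ∧ X ≠ I := by
      by_contra hcon
      push Not at hcon
      have hsub : (Finset.univ.erase (0 : Fin 2 → ZMod 13)) ⊆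
          (B ×ˢ B).image (fun q => q.1 - q.2) ∪ (I ×ˢ I).image (fun q => q.1 - q.2) := by
        intro δ hδ
        have hδ0 : δ ≠ 0 := (Finset.mem_erase.1 hδ).1
        have h := D.hlam 0 δ hδ0.symm
        have : (𝓑.filter (fun B => (0 : Fin 2 → ZMod 13) ∈ B ∧ δ ∈ B)).Nonempty := by
          rw [← Finset.card_pos, h]; norm_num
        obtain ⟨E, hE⟩ := this
        rw [Finset.mem_filter] at hE
        obtain ⟨v, hv⟩ := D.exists_base hE.1
        have m0 : 0 + v ∈ E.image (fun x => x + v) :=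
          Finset.mem_image.2 ⟨0, hE.2.1, rfl⟩
        have m1 : δ + v ∈ E.image (fun x => x + v) :=
          Finset.mem_image.2 ⟨δ, hE.2.2, rfl⟩
        rw [Finset.mem_union]
        by_cases hEB : E.image (fun x => x + v) = B
        · left
          rw [hEB] at m0 m1
          exact Finset.mem_image.2 ⟨(δ + v, 0 + v), Finset.mem_product.2 ⟨m1, m0⟩, by simp⟩
        · right
          rw [hcon _ hv hEB] at m0 m1
          exact Finset.mem_image.2 ⟨(δ + v, 0 + v), Finset.mem_product.2 ⟨m1, m0⟩, by simp⟩
      have hle := Finset.card_le_card hsub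
      have hle2 := (hle.trans (Finset.card_union_le _ _)).trans
        (Nat.add_le_add Finset.card_image_le Finset.card_image_le)
      rw [Finset.card_product, Finset.card_product, D.hk B hB.1, D.hk I hIb.1,
        Finset.card_erase_of_mem (Finset.mem_univ _), Finset.card_univ, Fintype.card_fun,
        ZMod.card, Fintype.card_fin] at hle2
      norm_num at hle2
    obtain ⟨X, hXb, hXB, hXI⟩ := hX
    obtain ⟨x, hx⟩ := hne
    have hneX : X.Nonempty := by rw [← Finset.card_pos, D.hk X hXb.1]; omega
    obtain ⟨y, hy⟩ := hneX
    obtain ⟨g, hg, h1, -⟩ := D.base_flag hB hXb hx hy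
    refine ⟨g, ?_⟩
    intro c hc s hs t ht s' hs' t' ht' hst hor h
    obtain ⟨Y, hY, hYc⟩ := hsc c hc
    have hYb : Base 𝓑 Y := by rcases hY with rfl | rfl <;> assumption
    have hXY : X ≠ Y := by rcases hY with rfl | rfl <;> assumption
    have gs : g s ∈ X := by rw [← h1]; exact Finset.mem_image_of_mem _ hs
    have gt : g t ∈ X := by rw [← h1]; exact Finset.mem_image_of_mem _ ht
    have hc0 : c ≠ 0 := by
      rintro rfl
      simp at hc
    rw [map_sub, smul_sub] at h
    rcases hor with hor | hor
    · exact hXY (D.k2 hXb hYb (hneg hXb) gs gt (hYc _ hs') (hYc _ ht')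
        (fun e => hst (g.injective e)) (fun e => hor (g.injective (by rw [e, map_neg]))) h).1
    · exact hXY (D.k2 hYb hXb (hneg hYb) (hYc _ hs') (hYc _ ht') gs gt
        (fun e => hor.1 ((smul_right_inj hc0).1 e))
        (fun e => hor.2 ((smul_right_inj hc0).1 (by rw [e, smul_neg]))) h.symm).1.symm

/-! Finite computation over `(ℤ/13)²`; vectors are pairs of natural numbers. -/

def cd (v : ℕ × ℕ) : ℕ := Nat.add (Nat.mul (Nat.mod v.1 13) 13) (Nat.mod v.2 13)
def vneg (v : ℕ × ℕ) : ℕ × ℕ := (Nat.mul 12 v.1, Nat.mul 12 v.2)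
def vsub (u v : ℕ × ℕ) : ℕ × ℕ := (Nat.add u.1 (Nat.mul 12 v.1), Nat.add u.2 (Nat.mul 12 v.2))
def vsm (c : ℕ) (v : ℕ × ℕ) : ℕ × ℕ := (Nat.mul c v.1, Nat.mul c v.2)
def vlin (u v q : ℕ × ℕ) : ℕ × ℕ :=
  (Nat.add (Nat.mul q.1 u.1) (Nat.mul q.2 v.1), Nat.add (Nat.mul q.1 u.2) (Nat.mul q.2 v.2))
def tb (m n : ℕ) : Bool := Nat.beq (Nat.land (Nat.shiftRight m n) 1) 1
def veq (u v : ℕ × ℕ) : Bool := Nat.beq (cd u) (cd v)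

/-- some difference of a pair in `P` violates the design conditions for the points in `L`. -/
def badc (P : List ((ℕ × ℕ) × (ℕ × ℕ))) (L : List (ℕ × ℕ)) : Bool :=
  P.any fun st => (!veq st.1 st.2 && !veq st.1 (vneg st.2)) &&
    L.any fun s' => L.any fun t' =>
      (veq (vsub st.1 st.2) (vsub s' t') && (!veq t' st.2 && !veq t' (vneg st.1))) ||
      veq (vsub st.1 st.2) (vsm 5 (vsub s' t'))

def L2 (z : ℕ × ℕ) : List (ℕ × ℕ) := [(1, 0), (12, 0), z, vneg z]
def P2 (z : ℕ × ℕ) : List ((ℕ × ℕ) × (ℕ × ℕ)) := [((1, 0), z), ((1, 0), vneg z)]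
def L3 (z : ℕ × ℕ) : List (ℕ × ℕ) := [(1, 0), (12, 0), (0, 1), (0, 12), z, vneg z]
def P3 (z : ℕ × ℕ) : List ((ℕ × ℕ) × (ℕ × ℕ)) :=
  [((1, 0), (0, 1)), ((1, 0), (0, 12)), ((1, 0), z), ((1, 0), vneg z), ((0, 1), z),
    ((0, 1), vneg z)]
def L4 (z w : ℕ × ℕ) : List (ℕ × ℕ) :=
  [(1, 0), (12, 0), (0, 1), (0, 12), z, vneg z, w, vneg w]
def P4 (z w : ℕ × ℕ) : List ((ℕ × ℕ) × (ℕ × ℕ)) :=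
  [((1, 0), (0, 1)), ((1, 0), (0, 12)), ((1, 0), z), ((1, 0), vneg z), ((0, 1), z),
    ((0, 1), vneg z), ((1, 0), w), ((1, 0), vneg w), ((0, 1), w),
    ((0, 1), vneg w), (z, w), (z, vneg w)]

def vmem (v : ℕ × ℕ) (L : List (ℕ × ℕ)) : Bool := L.any fun y => veq v y

def transc (z w : ℕ × ℕ) : Bool :=
  [(0, 1), z, w].all fun τ => (L4 z w).any fun u =>
    (!veq u τ && !veq u (vneg τ)) && (vmem (vlin τ u z) (L4 z w) && vmem (vlin τ u w) (L4 z w))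

/-- representatives of nonzero vectors modulo sign -/
def hf : List (ℕ × ℕ) :=
  [(0, 1), (0, 2), (0, 3), (0, 4), (0, 5), (0, 6), (1, 0), (1, 1), (1, 2), (1, 3), (1, 4), (1, 5),
  (1, 6), (1, 7), (1, 8), (1, 9), (1, 10), (1, 11), (1, 12), (2, 0), (2, 1), (2, 2), (2, 3), (2,
  4), (2, 5), (2, 6), (2, 7), (2, 8), (2, 9), (2, 10), (2, 11), (2, 12), (3, 0), (3, 1), (3, 2),
  (3, 3), (3, 4), (3, 5), (3, 6), (3, 7), (3, 8), (3, 9), (3, 10), (3, 11), (3, 12), (4, 0), (4,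
  1), (4, 2), (4, 3), (4, 4), (4, 5), (4, 6), (4, 7), (4, 8), (4, 9), (4, 10), (4, 11), (4, 12),
  (5, 0), (5, 1), (5, 2), (5, 3), (5, 4), (5, 5), (5, 6), (5, 7), (5, 8), (5, 9), (5, 10), (5,
  11), (5, 12), (6, 0), (6, 1), (6, 2), (6, 3), (6, 4), (6, 5), (6, 6), (6, 7), (6, 8), (6, 9),
  (6, 10), (6, 11), (6, 12)]
def zl : List (ℕ × ℕ) :=
  [(0, 2), (0, 3), (0, 4), (0, 5), (0, 6), (1, 1), (1, 2), (1, 3), (1, 4), (1, 5), (1, 6), (2, 2),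
  (2, 3), (2, 4), (2, 5), (2, 6), (3, 3), (3, 4), (3, 5), (3, 6), (4, 4), (4, 5), (4, 6), (5, 5),
  (5, 6), (6, 6)]

def check1 : Bool := zl.all fun z => badc (P3 z) (L3 z) || hf.all fun w =>
  vmem w (L3 z) || (!transc z w || (badc (P4 z w) (L4 z w) ||
    ([((2, 4), (4, 2)), ((2, 6), (6, 11)), ((3, 4), (4, 10)), ((3, 6), (6, 3))] :
      List ((ℕ × ℕ) × (ℕ × ℕ))).any fun q => veq z q.1 && veq w q.2))

set_option maxRecDepth 100000 in
theorem check1_true : check1 = true := by decide +kernel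

def r13 : List ℕ := [0, 1, 2, 3, 4, 5, 6, 7, 8, 9, 10, 11, 12]

set_option maxRecDepth 100000 in
theorem check0_true : ∀ x ∈ r13, x ≠ 0 → x ≠ 1 → x ≠ 12 → badc (P2 (x, 0)) (L2 (x, 0)) = true := by
  decide +kernel

/-- representatives of nonzero vectors modulo multiplication by fourth roots of unity -/
def rp : List (ℕ × ℕ) :=
  [(0, 1), (0, 2), (0, 4), (1, 0), (1, 1), (1, 2), (1, 3), (1, 4), (1, 5), (1, 6), (1, 7), (1, 8),
  (1, 9), (1, 10), (1, 11), (1, 12), (2, 0), (2, 1), (2, 2), (2, 3), (2, 4), (2, 5), (2, 6), (2,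
  7), (2, 8), (2, 9), (2, 10), (2, 11), (2, 12), (4, 0), (4, 1), (4, 2), (4, 3), (4, 4), (4, 5),
  (4, 6), (4, 7), (4, 8), (4, 9), (4, 10), (4, 11), (4, 12)]
def pts : List (ℕ × ℕ) := r13.flatMap fun x => r13.map fun y => (x, y)

def qs (z w : ℕ × ℕ) : List (ℕ × ℕ) := (P4 z w).map fun st => vsub st.1 st.2
def ts (z w : ℕ × ℕ) : List (ℕ × ℕ) := [(2, 0), (0, 2), vsm 2 z, vsm 2 w]

/-- every set bit of `D` (below 169) is the code of zero or of a multiple of an element of `l` -/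
def maskc (D : ℕ) (l : List (ℕ × ℕ)) : Bool :=
  pts.all fun v => !tb D (cd v) || (veq v (0, 0) || l.any fun x =>
    veq v x || (veq v (vsm 5 x) || (veq v (vsm 12 x) || veq v (vsm 8 x))))

def gcheck (q T : List (ℕ × ℕ)) (D0 D1 : ℕ) : Bool :=
  rp.all fun u => tb D1 (cd (vsm 2 u)) || pts.all fun v => tb D1 (cd (vsm 2 v)) ||
    (q.any (fun x => tb D0 (cd (vlin u v x))) || (T.any (fun x => tb D1 (cd (vlin u v x))) ||
      r13.any (fun c => veq (vsm c u) v)))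
def vlist (l l' : List (ℕ × ℕ)) : Bool := l.all fun x => vmem x l'
def pnon (P : List ((ℕ × ℕ) × (ℕ × ℕ))) : Bool :=
  P.all fun st => !veq st.1 st.2 && !veq st.1 (vneg st.2)
def gfull (z w : ℕ × ℕ) (q T : List (ℕ × ℕ)) (D0 D1 : ℕ) : Bool :=
  gcheck q T D0 D1 && (maskc D0 (qs z w ++ ts z w) && (maskc D1 (qs z w) &&
    (vlist q (qs z w) && (vlist T (ts z w) && pnon (P4 z w)))))

theorem rp_spec : ∀ s t : ZMod 13, s ≠ 0 ∨ t ≠ 0 → ∃ u ∈ rp, ∃ c ∈ ([1, 5, -1, -5] : List (ZMod 13)),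
    c * s = u.1 ∧ c * t = u.2 := by
  decide +kernel

theorem hf_spec : ∀ s t : ZMod 13, s ≠ 0 ∨ t ≠ 0 → ∃ u ∈ hf,
    (s = u.1 ∧ t = u.2) ∨ (s = -u.1 ∧ t = -u.2) := by
  decide +kernel

set_option synthInstance.maxSize 1000 in
set_option synthInstance.maxHeartbeats 400000 in
theorem zl_spec : ∀ x < 7, ∀ y < 7, x ≤ y → (x, y) ∈ zl ∨ (x, y) = (0, 0) ∨ (x, y) = (0, 1) := by
  decide +kernel

theorem abs_spec : ∀ s : ZMod 13, ∃ n < 7, s = (n : ℕ) ∨ s = -(n : ℕ) := by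
  decide +kernel

set_option maxRecDepth 100000 in
theorem gc0 : ∃ q T D0 D1, gfull (2, 4) (4, 2) q T D0 D1 = true :=
  ⟨[(1, 12), (1, 1), (12, 9), (3, 4), (11, 10), (2, 5), (10, 11), (5, 2), (9, 12), (4, 3), (11, 2), (6, 6)],
    [(2, 0), (0, 2), (4, 8), (8, 4)],
    520492410728398567179773516996920195955551320099853,
    514646393027335909537455570003337041356715114840065, by
    decide +kernel⟩

set_option maxRecDepth 100000 in
theorem gc1 : ∃ q T D0 D1, gfull (2, 6) (6, 11) q T D0 D1 = true :=
  ⟨[(1, 12), (1, 1), (12, 7), (3, 6), (11, 8), (2, 7), (8, 2), (7, 11), (7, 3), (6, 12), (9, 8), (8, 4)],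
    [(2, 0), (0, 2), (4, 12), (12, 9)],
    439373224430698362509826128692195839539740594031629,
    392605160884375406788605893584625530227178847354881, by
    decide +kernel⟩

set_option maxRecDepth 100000 in
theorem gc2 : ∃ q T D0 D1, gfull (3, 4) (4, 10) q T D0 D1 = true :=
  ⟨[(1, 12), (1, 1), (11, 9), (4, 4), (10, 10), (3, 5), (10, 3), (5, 10), (9, 4), (4, 11), (12, 7), (7, 1)],
    [(2, 0), (0, 2), (6, 8), (8, 7)],
    574581456111668273773966113194823926480837552950285,
    573119943321923074792697492009926533304117463924737, by
    decide +kernel⟩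

set_option maxRecDepth 100000 in
theorem gc3 : ∃ q T D0 D1, gfull (3, 6) (6, 3) q T D0 D1 = true :=
  ⟨[(1, 12), (1, 1), (11, 7), (4, 6), (10, 8), (3, 7), (8, 10), (7, 3), (7, 11), (6, 4), (10, 3), (9, 9)],
    [(2, 0), (0, 2), (6, 12), (12, 6)],
    380540172996010312499593813246286700934160014396429,
    374694155294947654857275866252703546335323809136641, by
    decide +kernel⟩


def ev (a b : Fin 2 → ZMod 13) (v : ℕ × ℕ) : Fin 2 → ZMod 13 :=
  (v.1 : ZMod 13) • a + (v.2 : ZMod 13) • b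

structure Bas (a b : Fin 2 → ZMod 13) : Prop where
  inj : ∀ s t s' t' : ZMod 13, s • a + t • b = s' • a + t' • b → s = s' ∧ t = t'
  surj : ∀ x, ∃ s t : ZMod 13, x = s • a + t • b

theorem twelve : (12 : ZMod 13) = -1 := by decide

section
variable {a b : Fin 2 → ZMod 13}

theorem ev_vneg (v : ℕ × ℕ) : ev a b (vneg v) = -ev a b v := by
  simp only [ev, vneg, Nat.mul_eq, Nat.cast_mul, Nat.cast_ofNat, twelve]
  module

theorem ev_vsub (u v : ℕ × ℕ) : ev a b (vsub u v) = ev a b u - ev a b v := by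
  simp only [ev, vsub, Nat.mul_eq, Nat.add_eq, Nat.cast_add, Nat.cast_mul, Nat.cast_ofNat, twelve]
  module

theorem ev_vsm (c : ℕ) (v : ℕ × ℕ) : ev a b (vsm c v) = (c : ZMod 13) • ev a b v := by
  simp only [ev, vsm, Nat.mul_eq, Nat.cast_mul]
  module

theorem ev_vlin (f : (Fin 2 → ZMod 13) →ₗ[ZMod 13] (Fin 2 → ZMod 13)) (u v q : ℕ × ℕ)
    (hu : f a = ev a b u) (hv : f b = ev a b v) : ev a b (vlin u v q) = f (ev a b q) := by
  rw [ev, ev, map_add, map_smul, map_smul, hu, hv]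
  simp only [ev, vlin, Nat.mul_eq, Nat.add_eq, Nat.cast_add, Nat.cast_mul]
  module

theorem cd_iff (u v : ℕ × ℕ) : cd u = cd v ↔ u.1 % 13 = v.1 % 13 ∧ u.2 % 13 = v.2 % 13 := by
  have h : ∀ w : ℕ × ℕ, cd w = w.1 % 13 * 13 + w.2 % 13 := fun _ => rfl
  rw [h, h]
  omega

theorem ev_of_cd {u v : ℕ × ℕ} (h : cd u = cd v) : ev a b u = ev a b v := by
  rw [cd_iff] at h
  rw [ev, ev, (ZMod.natCast_eq_natCast_iff' _ _ 13).2 h.1, (ZMod.natCast_eq_natCast_iff' _ _ 13).2 h.2]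

theorem ev_of_veq {u v : ℕ × ℕ} (h : veq u v = true) : ev a b u = ev a b v :=
  ev_of_cd (Nat.eq_of_beq_eq_true h)

theorem Bas.veq_iff (hb : Bas a b) (u v : ℕ × ℕ) : veq u v = true ↔ ev a b u = ev a b v := by
  refine ⟨ev_of_veq, fun h => ?_⟩
  obtain ⟨h1, h2⟩ := hb.inj _ _ _ _ h
  have : cd u = cd v := by
    rw [cd_iff]
    exact ⟨(ZMod.natCast_eq_natCast_iff' _ _ 13).1 h1, (ZMod.natCast_eq_natCast_iff' _ _ 13).1 h2⟩
  rw [veq, this]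
  exact Nat.beq_refl _

theorem Bas.not_veq_iff (hb : Bas a b) (u v : ℕ × ℕ) :
    (!veq u v) = true ↔ ev a b u ≠ ev a b v := by
  rw [Bool.not_eq_true', ← Bool.not_eq_true, hb.veq_iff]

theorem ev_10 : ev a b (1, 0) = a := by simp [ev]
theorem ev_01 : ev a b (0, 1) = b := by simp [ev]
theorem ev_12 : ev a b (12, 0) = -a := by simp [ev, twelve]
theorem ev_012 : ev a b (0, 12) = -b := by simp [ev, twelve]

theorem bas_of [Fact (Nat.Prime 13)] (ha : a ≠ 0) (h : ∀ c : ZMod 13, b ≠ c • a) : Bas a b := by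
  have inj : ∀ s t s' t' : ZMod 13, s • a + t • b = s' • a + t' • b → s = s' ∧ t = t' := by
    intro s t s' t' he
    have ht : t = t' := by
      by_contra hne
      have hne' : t - t' ≠ 0 := sub_ne_zero.2 hne
      apply h ((t - t')⁻¹ * (s' - s))
      have h1 : (t - t') • b = (s' - s) • a := by
        rw [sub_smul, sub_smul, sub_eq_sub_iff_add_eq_add, add_comm, he, add_comm]
      rw [mul_smul, ← h1, smul_smul, inv_mul_cancel₀ hne', one_smul]
    subst ht
    have h1 : (s - s') • a = 0 := by
      rw [sub_smul, sub_eq_zero]; exact add_right_cancel he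
    rcases smul_eq_zero.1 h1 with h2 | h2
    · exact ⟨sub_eq_zero.1 h2, rfl⟩
    · exact absurd h2 ha
  refine ⟨inj, ?_⟩
  have hbij : Function.Bijective (fun q : ZMod 13 × ZMod 13 => q.1 • a + q.2 • b) := by
    rw [Fintype.bijective_iff_injective_and_card]
    refine ⟨?_, ?_⟩
    · rintro ⟨s, t⟩ ⟨s', t'⟩ he
      obtain ⟨h1, h2⟩ := inj s t s' t' he
      rw [h1, h2]
    · rw [Fintype.card_prod, Fintype.card_fun, ZMod.card, Fintype.card_fin]; norm_num
  intro x
  obtain ⟨⟨s, t⟩, hst⟩ := hbij.2 x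
  exact ⟨s, t, hst.symm⟩

theorem Bas.swap (h : Bas a b) : Bas b a := by
  refine ⟨fun s t s' t' he => ?_, fun x => ?_⟩
  · have := h.inj t s t' s' (by rw [add_comm, he, add_comm])
    exact this.symm
  · obtain ⟨s, t, hst⟩ := h.surj x
    exact ⟨t, s, by rw [hst, add_comm]⟩

theorem Bas.negl (h : Bas a b) : Bas (-a) b := by
  refine ⟨fun s t s' t' he => ?_, fun x => ?_⟩
  · have := h.inj (-s) t (-s') t' (by simpa using he)
    exact ⟨neg_injective this.1, this.2⟩
  · obtain ⟨s, t, hst⟩ := h.surj x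
    exact ⟨-s, t, by rw [hst]; simp⟩

theorem Bas.negr (h : Bas a b) : Bas a (-b) := h.swap.negl.swap

theorem Bas.ne (h : Bas a b) : b ≠ a ∧ b ≠ -a ∧ a ≠ 0 ∧ ∀ c : ZMod 13, b ≠ c • a := by
  have key : ∀ c : ZMod 13, b ≠ c • a := by
    intro c hc
    have := (h.inj 0 1 c 0 (by simpa using hc)).2
    exact absurd this (by decide)
  refine ⟨by simpa using key 1, by simpa using key (-1), ?_, key⟩
  intro ha
  have := (h.inj 0 0 1 0 (by simp [ha])).1
  exact absurd this (by decide)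

theorem Bas.exists_nat (h : Bas a b) (x) : ∃ v ∈ pts, x = ev a b v := by
  obtain ⟨s, t, hst⟩ := h.surj x
  have hr : ∀ s : ZMod 13, s.val ∈ r13 ∧ ((s.val : ℕ) : ZMod 13) = s := by decide
  refine ⟨(s.val, t.val), ?_, ?_⟩
  · rw [pts, List.mem_flatMap]
    exact ⟨_, (hr s).1, List.mem_map.2 ⟨_, (hr t).1, rfl⟩⟩
  · rw [hst, ev, (hr s).2, (hr t).2]

theorem badc_false {B} (hS : S13 B) (hb : Bas a b) {P L}
    (hP : ∀ st ∈ P, ev a b (Prod.fst st) ∈ B ∧ ev a b (Prod.snd st) ∈ B) (hL : ∀ s ∈ L, ev a b s ∈ B)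
    (h : badc P L = true) : False := by
  simp only [badc, List.any_eq_true, Bool.and_eq_true, Bool.or_eq_true, hb.not_veq_iff, hb.veq_iff,
    ev_vneg, ev_vsub, ev_vsm] at h
  obtain ⟨st, hst, ⟨h1, h2⟩, s', hs', t', ht', h3⟩ := h
  obtain ⟨p1, p2⟩ := hP st hst
  rcases h3 with ⟨h3, h4, h5⟩ | h3
  · rcases hS.n2 _ p1 _ p2 _ (hL _ hs') _ (hL _ ht') h1 h2 h3 with h | h
    · exact h4 h
    · exact h5 h
  · exact hS.n5 _ p1 _ p2 _ (hL _ hs') _ (hL _ ht') h1 h2 h3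

theorem vmem_true (hb : Bas a b) {v L} (h : ∃ u ∈ L, ev a b v = ev a b u) : vmem v L = true := by
  simpa only [vmem, List.any_eq_true, hb.veq_iff] using h

theorem mask_spec (hb : Bas a b) {D l} (h : maskc D l = true) {v} (hv : tb D (cd v) = true) :
    ev a b v = 0 ∨ ∃ x ∈ l, ∃ c : ZMod 13, c ^ 4 = 1 ∧ ev a b v = c • ev a b x := by
  obtain ⟨v', hv', e⟩ := hb.exists_nat (ev a b v)
  have hcd : cd v = cd v' := Nat.eq_of_beq_eq_true ((hb.veq_iff v v').2 e)
  rw [maskc, List.all_eq_true] at h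
  have h' := h v' hv'
  rw [← hcd, hv] at h'
  simp only [Bool.not_true, Bool.false_or, Bool.or_eq_true, List.any_eq_true, hb.veq_iff, ← e,
    ev_vsm] at h'
  rcases h' with h' | ⟨x, hx, h'⟩
  · left; rw [h']; simp [ev]
  · right
    refine ⟨x, hx, ?_⟩
    rcases h' with h' | h' | h' | h'
    · exact ⟨1, by decide, by rw [h', one_smul]⟩
    · exact ⟨_, by decide, h'⟩
    · exact ⟨_, by decide, h'⟩
    · exact ⟨_, by decide, h'⟩

theorem card_pair_step {S : Finset (Fin 2 → ZMod 13)} {n : ℕ} (hS : S.card = n)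
    {x : Fin 2 → ZMod 13} (h1 : x ∉ S) (h2 : -x ∉ S) (h3 : x ≠ -x) :
    (insert x (insert (-x) S)).card = n + 2 := by
  rw [Finset.card_insert_of_notMem, Finset.card_insert_of_notMem h2, hS]
  rw [Finset.mem_insert]
  rintro (h | h)
  · exact h3 h
  · exact h1 h

end

theorem ne_neg13 {x : Fin 2 → ZMod 13} (hx : x ≠ 0) : x ≠ -x := by
  intro h
  apply hx
  have key : ∀ s : ZMod 13, s = -s → s = 0 := by decide
  ext j
  exact key _ (congrFun h j)

theorem exists_new {B : Finset (Fin 2 → ZMod 13)} (hc : B.card = 8)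
    (S : Finset (Fin 2 → ZMod 13)) (hS : S.card ≤ 6) : ∃ x ∈ B, x ∉ S := by
  by_contra h
  push Not at h
  have := Finset.card_le_card (show B ⊆ S from h)
  omega

theorem quart13 : ∀ c ∈ ([1, 5, -1, -5] : List (ZMod 13)), c ^ 4 = 1 := by decide

theorem val13 : ∀ s : ZMod 13, s.val ∈ r13 ∧ ((s.val : ℕ) : ZMod 13) = s ∧ (s.val = 0 → s = 0) ∧
      (s.val = 1 → s = 1) ∧ (s.val = 12 → s = -1) := by decide

theorem P3_sub (z w : ℕ × ℕ) : ∀ st ∈ P3 z, st ∈ P4 z w := by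
  intro st hst
  have : P4 z w = P3 z ++ [((1, 0), w), ((1, 0), vneg w), ((0, 1), w),
    ((0, 1), vneg w), (z, w), (z, vneg w)] := rfl
  rw [this]
  exact List.mem_append_left _ hst

theorem L3_sub (z w : ℕ × ℕ) : ∀ s ∈ L3 z, s ∈ L4 z w := by
  intro st hst
  have : L4 z w = L3 z ++ [w, vneg w] := rfl
  rw [this]
  exact List.mem_append_left _ hst

section
variable {a b : Fin 2 → ZMod 13} {B : Finset (Fin 2 → ZMod 13)}

/-- A nontrivial difference. -/
def DiffN (B : Finset (Fin 2 → ZMod 13)) (y : Fin 2 → ZMod 13) : Prop :=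
  ∃ s ∈ B, ∃ t ∈ B, s ≠ t ∧ s ≠ -t ∧ y = s - t

/-- Any difference. -/
def DiffA (B : Finset (Fin 2 → ZMod 13)) (y : Fin 2 → ZMod 13) : Prop :=
  ∃ s ∈ B, ∃ t ∈ B, s ≠ t ∧ y = s - t

theorem DiffN.toA {y} (h : DiffN B y) : DiffA B y := by
  obtain ⟨s, hs, t, ht, h1, -, h2⟩ := h
  exact ⟨s, hs, t, ht, h1, h2⟩

theorem DiffA.ne {y} (h : DiffA B y) : y ≠ 0 := by
  obtain ⟨s, hs, t, ht, h1, h2⟩ := h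
  rw [h2]; exact sub_ne_zero.2 h1

theorem L4_mem (hS : S13 B) (ha : a ∈ B) (hb : b ∈ B) {z w} (hz : ev a b z ∈ B)
    (hw : ev a b w ∈ B) : ∀ s ∈ L4 z w, ev a b s ∈ B := by
  intro s hs
  simp only [L4, List.mem_cons, List.not_mem_nil, or_false] at hs
  rcases hs with rfl | rfl | rfl | rfl | rfl | rfl | rfl | rfl
  · rwa [ev_10]
  · rw [ev_12]; exact hS.neg _ ha
  · rwa [ev_01]
  · rw [ev_012]; exact hS.neg _ hb
  · exact hz
  · rw [ev_vneg]; exact hS.neg _ hz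
  · exact hw
  · rw [ev_vneg]; exact hS.neg _ hw

theorem P4_mem (hS : S13 B) (ha : a ∈ B) (hb : b ∈ B) {z w} (hz : ev a b z ∈ B)
    (hw : ev a b w ∈ B) : ∀ st ∈ P4 z w, ev a b (Prod.fst st) ∈ B ∧ ev a b (Prod.snd st) ∈ B := by
  have hL := L4_mem hS ha hb hz hw
  intro st hst
  have : st.1 ∈ L4 z w ∧ st.2 ∈ L4 z w := by
    simp only [P4, List.mem_cons, List.not_mem_nil, or_false] at hst
    rcases hst with rfl | rfl | rfl | rfl | rfl | rfl | rfl | rfl | rfl | rfl | rfl | rfl <;>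
      simp [L4]
  exact ⟨hL _ this.1, hL _ this.2⟩

theorem gfull_false [Fact (Nat.Prime 13)] (hS : S13 B) (hbas : Bas a b) (ha : a ∈ B) (hb : b ∈ B)
    {z w} (hz : ev a b z ∈ B) (hw : ev a b w ∈ B)
    (h : ∃ q T D0 D1, gfull z w q T D0 D1 = true) : False := by
  obtain ⟨q, T, D0, D1, h⟩ := h
  simp only [gfull, Bool.and_eq_true] at h
  obtain ⟨hg, hD0, hD1, hq, hT, hP⟩ := h
  have hqs : ∀ x ∈ qs z w, DiffN B (ev a b x) := by
    intro x hx
    rw [qs, List.mem_map] at hx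
    obtain ⟨st, hst, rfl⟩ := hx
    rw [pnon, List.all_eq_true] at hP
    have h := hP st hst
    simp only [Bool.and_eq_true, hbas.not_veq_iff, ev_vneg] at h
    have hm := P4_mem hS ha hb hz hw st hst
    exact ⟨_, hm.1, _, hm.2, h.1, h.2, ev_vsub _ _⟩
  have two : ∀ x ∈ B, DiffA B ((2 : ZMod 13) • x) := by
    intro x hx
    refine ⟨x, hx, -x, hS.neg x hx, ne_neg13 (fun h => hS.zero (h ▸ hx)), ?_⟩
    rw [two_smul]; abel
  have hts : ∀ x ∈ ts z w, DiffA B (ev a b x) := by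
    intro x hx
    simp only [ts, List.mem_cons, List.not_mem_nil, or_false] at hx
    rcases hx with rfl | rfl | rfl | rfl
    · simpa [ev] using two a ha
    · simpa [ev] using two b hb
    · rw [ev_vsm]; exact two _ hz
    · rw [ev_vsm]; exact two _ hw
  obtain ⟨g, hgc⟩ := hS.cmp
  obtain ⟨s, t, hst⟩ := hbas.surj (g a)
  have hst0 : s ≠ 0 ∨ t ≠ 0 := by
    by_contra hcon
    push Not at hcon
    rw [hcon.1, hcon.2] at hst
    simp only [zero_smul, add_zero] at hst
    exact hbas.ne.2.2.1 (by simpa using hst)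
  obtain ⟨u, hu, c, hc, hc1, hc2⟩ := rp_spec s t hst0
  have hc4 : c ^ 4 = 1 := quart13 c hc
  set f : (Fin 2 → ZMod 13) →ₗ[ZMod 13] (Fin 2 → ZMod 13) :=
    c • (g : (Fin 2 → ZMod 13) →ₗ[ZMod 13] (Fin 2 → ZMod 13)) with hf
  have hfx : ∀ x, f x = c • g x := fun x => rfl
  have hfg : ∀ {x y}, f x = y → g x = c ^ 3 • y := by
    intro x y h
    rw [← h, hfx, smul_smul, ← pow_succ, hc4, one_smul]
  have hf0 : ∀ {x}, f x = 0 → x = 0 := by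
    intro x h
    simpa using hfg h
  have hNA : ∀ (y y' : Fin 2 → ZMod 13) (c' : ZMod 13), DiffN B y → DiffA B y' → c' ^ 4 = 1 → f y ≠ c' • y' := by
    rintro y y' c' ⟨s, hs, t, ht, h1, h2, rfl⟩ ⟨s', hs', t', ht', -, rfl⟩ hc' h
    have := hfg h
    rw [smul_smul] at this
    refine hgc _ ?_ s hs t ht s' hs' t' ht' h1 (Or.inl h2) this
    rw [mul_pow, hc', ← pow_mul, mul_comm 3 4, pow_mul, hc4]; simp
  have hAN : ∀ (y y' : Fin 2 → ZMod 13) (c' : ZMod 13), DiffA B y → DiffN B y' → c' ^ 4 = 1 → f y ≠ c' • y' := by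
    rintro y y' c' ⟨s, hs, t, ht, h1, rfl⟩ ⟨s', hs', t', ht', h2, h3, rfl⟩ hc' h
    have := hfg h
    rw [smul_smul] at this
    refine hgc _ ?_ s hs t ht s' hs' t' ht' h1 (Or.inr ⟨h2, h3⟩) this
    rw [mul_pow, hc', ← pow_mul, mul_comm 3 4, pow_mul, hc4]; simp
  have fa : f a = ev a b u := by
    rw [hfx, hst, smul_add, smul_smul, smul_smul, hc1, hc2]; rfl
  obtain ⟨v, hv, fb⟩ := hbas.exists_nat (f b)
  have useA : ∀ {x n}, DiffA B x → f x = ev a b n → tb D1 (cd n) = true → False := by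
    intro x n hx hxn htb
    rcases mask_spec hbas hD1 htb with h | ⟨x', hx', c', hc', h⟩
    · exact hx.ne (hf0 (hxn.trans h))
    · exact hAN _ _ c' hx (hqs _ hx') hc' (hxn.trans h)
  have useN : ∀ {x n}, DiffN B x → f x = ev a b n → tb D0 (cd n) = true → False := by
    intro x n hx hxn htb
    rcases mask_spec hbas hD0 htb with h | ⟨x', hx', c', hc', h⟩
    · exact hx.toA.ne (hf0 (hxn.trans h))
    · refine hNA _ _ c' hx ?_ hc' (hxn.trans h)
      rcases List.mem_append.1 hx' with h | h
      · exact (hqs _ h).toA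
      · exact hts _ h
  rw [gcheck, List.all_eq_true] at hg
  have hg' := hg u hu
  rw [Bool.or_eq_true] at hg'
  rcases hg' with hg' | hg'
  · exact useA (two a ha) (by rw [ev_vsm, map_smul, fa]; rfl) hg'
  rw [List.all_eq_true] at hg'
  have hg'' := hg' v hv
  simp only [Bool.or_eq_true, List.any_eq_true] at hg''
  simp only [vlist, vmem, List.all_eq_true, List.any_eq_true] at hq hT
  rcases hg'' with h | ⟨x, hx, h⟩ | ⟨x, hx, h⟩ | ⟨m, -, h⟩
  · exact useA (two b hb) (by rw [ev_vsm, map_smul, fb]; rfl) h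
  · obtain ⟨y, hy, hxy⟩ := hq x hx
    exact useN (hqs y hy) (by rw [ev_vlin f u v x fa fb, ev_of_veq hxy]) h
  · obtain ⟨y, hy, hxy⟩ := hT x hx
    exact useA (hts y hy) (by rw [ev_vlin f u v x fa fb, ev_of_veq hxy]) h
  · have h1 := ev_of_veq (a := a) (b := b) h
    rw [ev_vsm, ← fa, ← fb, ← map_smul, ← sub_eq_zero, ← map_sub] at h1
    exact hbas.ne.2.2.2 m (sub_eq_zero.1 (hf0 h1)).symm

theorem S13_basis_false [Fact (Nat.Prime 13)] (hS : S13 B) (hbas : Bas a b) (ha : a ∈ B) (hb : b ∈ B)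
    {x y : ℕ} (hxy : x ≤ y) (hy : y < 7) (hz : ev a b (x, y) ∈ B)
    (h1 : ev a b (x, y) ≠ a) (h2 : ev a b (x, y) ≠ -a) (h3 : ev a b (x, y) ≠ b)
    (h4 : ev a b (x, y) ≠ -b) : False := by
  have nz : ∀ {x}, x ∈ B → x ≠ 0 := fun hx h => hS.zero (h ▸ hx)
  have hzl : (x, y) ∈ zl := by
    rcases zl_spec x (by omega) y hy hxy with h | h | h
    · exact h
    · rw [h] at hz
      exact absurd hz (by simpa [ev] using hS.zero)
    · rw [h, ev_01] at h3
      exact absurd rfl h3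
  generalize (x, y) = z at *
  obtain ⟨w0, hw0, hw0n⟩ := exists_new hS.card {a, -a, b, -b, ev a b z, -ev a b z}
    Finset.card_le_six
  simp only [Finset.mem_insert, Finset.mem_singleton, not_or] at hw0n
  have hw : ∃ w ∈ hf, ev a b w ∈ B ∧ ev a b w ≠ a ∧ ev a b w ≠ -a ∧ ev a b w ≠ b ∧ ev a b w ≠ -b ∧
      ev a b w ≠ ev a b z ∧ ev a b w ≠ -ev a b z := by
    obtain ⟨s, t, hst⟩ := hbas.surj w0
    have hst0 : s ≠ 0 ∨ t ≠ 0 := by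
      by_contra hcon
      push Not at hcon
      rw [hcon.1, hcon.2] at hst
      simp only [zero_smul, add_zero] at hst
      exact nz hw0 hst
    obtain ⟨w, hw, h | h⟩ := hf_spec s t hst0
    · have e : ev a b w = w0 := by rw [hst, h.1, h.2]; rfl
      refine ⟨w, hw, ?_⟩
      rw [e]; exact ⟨hw0, hw0n⟩
    · have e : ev a b w = -w0 := by
        rw [hst, h.1, h.2, ev]; module
      refine ⟨w, hw, ?_⟩
      rw [e]
      refine ⟨hS.neg _ hw0, ?_⟩
      simp only [ne_eq, neg_inj, neg_eq_iff_eq_neg, neg_neg]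
      tauto
  obtain ⟨w, hwf, hwB, w1, w2, w3, w4, w5, w6⟩ := hw
  have hBL : ∀ x ∈ B, ∃ v ∈ L4 z w, x = ev a b v := by
    have c0 : (∅ : Finset (Fin 2 → ZMod 13)).card = 0 := rfl
    have c1 := card_pair_step c0 (x := a) (by simp) (by simp) (ne_neg13 (nz ha))
    have c2 := card_pair_step c1 (x := b) (by simp [hbas.ne.1, hbas.ne.2.1])
      (by simp [neg_eq_iff_eq_neg, hbas.ne.1, hbas.ne.2.1]) (ne_neg13 (nz hb))
    have c3 := card_pair_step c2 (x := ev a b z) (by simp [h1, h2, h3, h4])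
      (by simp [neg_eq_iff_eq_neg, h1, h2, h3, h4]) (ne_neg13 (nz hz))
    have c4 := card_pair_step c3 (x := ev a b w) (by simp [w1, w2, w3, w4, w5, w6])
      (by simp [neg_eq_iff_eq_neg, w1, w2, w3, w4, w5, w6]) (ne_neg13 (nz hwB))
    have hsub := Finset.eq_of_subset_of_card_le (t := B) (s := insert (ev a b w)
      (insert (-ev a b w) (insert (ev a b z) (insert (-ev a b z) (insert b (insert (-b)
        (insert a (insert (-a) ∅)))))))) (by
        intro x hx
        simp only [Finset.mem_insert, Finset.notMem_empty, or_false] at hx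
        rcases hx with rfl | rfl | rfl | rfl | rfl | rfl | rfl | rfl <;>
          first | assumption | (apply hS.neg; assumption)) (by rw [c4, hS.card])
    intro x hx
    rw [← hsub] at hx
    simp only [Finset.mem_insert, Finset.notMem_empty, or_false] at hx
    rcases hx with rfl | rfl | rfl | rfl | rfl | rfl | rfl | rfl
    · exact ⟨w, by simp [L4], rfl⟩
    · exact ⟨vneg w, by simp [L4], (ev_vneg _).symm⟩
    · exact ⟨z, by simp [L4], rfl⟩
    · exact ⟨vneg z, by simp [L4], (ev_vneg _).symm⟩
    · exact ⟨(0, 1), by simp [L4], ev_01.symm⟩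
    · exact ⟨(0, 12), by simp [L4], ev_012.symm⟩
    · exact ⟨(1, 0), by simp [L4], ev_10.symm⟩
    · exact ⟨(12, 0), by simp [L4], ev_12.symm⟩
  have hL := L4_mem hS ha hb hz hwB
  have hP := P4_mem hS ha hb hz hwB
  have htr : transc z w = true := by
    rw [transc, List.all_eq_true]
    intro τ hτ
    have hτB : ev a b τ ∈ B := by
      simp only [List.mem_cons, List.not_mem_nil, or_false] at hτ
      rcases hτ with rfl | rfl | rfl
      · rwa [ev_01]
      · exact hz
      · exact hwB
    obtain ⟨g, hg, hga⟩ := hS.tr a ha _ hτB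
    obtain ⟨u, hu, hub⟩ := hBL _ (hg b hb)
    rw [List.any_eq_true]
    refine ⟨u, hu, ?_⟩
    simp only [Bool.and_eq_true, hbas.not_veq_iff, ev_vneg]
    have hl : ∀ q, ev a b q ∈ B → vmem (vlin τ u q) (L4 z w) = true := by
      intro q hq
      apply vmem_true hbas
      rw [ev_vlin (g : (Fin 2 → ZMod 13) →ₗ[ZMod 13] (Fin 2 → ZMod 13)) τ u q hga hub]
      exact hBL _ (hg _ hq)
    refine ⟨⟨?_, ?_⟩, hl z hz, hl w hwB⟩
    · rw [← hub, ← hga]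
      exact fun h => hbas.ne.1 (g.injective h)
    · rw [← hub, ← hga, ← map_neg]
      exact fun h => hbas.ne.2.1 (g.injective h)
  have hchk := check1_true
  rw [check1, List.all_eq_true] at hchk
  have hchk' := hchk z hzl
  rw [Bool.or_eq_true] at hchk'
  rcases hchk' with h | h
  · refine badc_false hS hbas ?_ ?_ h
    · exact fun st hst => hP st (P3_sub z w st hst)
    · exact fun s hs => hL s (L3_sub z w s hs)
  rw [List.all_eq_true] at h
  have h' := h w hwf
  rw [htr] at h'
  simp only [Bool.not_true, Bool.false_or, Bool.or_eq_true] at h'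
  rcases h' with h' | h' | h'
  · simp only [vmem, List.any_eq_true, hbas.veq_iff, L3, List.mem_cons, List.not_mem_nil,
      or_false] at h'
    obtain ⟨y, hy, hwy⟩ := h'
    rcases hy with rfl | rfl | rfl | rfl | rfl | rfl
    · rw [ev_10] at hwy; exact w1 hwy
    · rw [ev_12] at hwy; exact w2 hwy
    · rw [ev_01] at hwy; exact w3 hwy
    · rw [ev_012] at hwy; exact w4 hwy
    · exact w5 hwy
    · rw [ev_vneg] at hwy; exact w6 hwy
  · exact badc_false hS hbas hP hL h'
  · simp only [List.any_eq_true, Bool.and_eq_true, hbas.veq_iff, List.mem_cons, List.not_mem_nil,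
      or_false] at h'
    obtain ⟨q, hq, e1, e2⟩ := h'
    rw [e1] at hz
    rw [e2] at hwB
    rcases hq with rfl | rfl | rfl | rfl
    · exact gfull_false hS hbas ha hb hz hwB gc0
    · exact gfull_false hS hbas ha hb hz hwB gc1
    · exact gfull_false hS hbas ha hb hz hwB gc2
    · exact gfull_false hS hbas ha hb hz hwB gc3

theorem S13_false [Fact (Nat.Prime 13)] (hS : S13 B) : False := by
  have nz : ∀ {x}, x ∈ B → x ≠ 0 := fun hx h => hS.zero (h ▸ hx)
  obtain ⟨a, ha, -⟩ := exists_new hS.card ∅ (by simp)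
  by_cases hex : ∃ b ∈ B, ∀ c : ZMod 13, b ≠ c • a
  · obtain ⟨b, hb, hbc⟩ := hex
    have hbas := bas_of (nz ha) hbc
    obtain ⟨z, hz, hzn⟩ := exists_new hS.card {a, -a, b, -b}
      (Finset.card_le_four.trans (by norm_num))
    simp only [Finset.mem_insert, Finset.mem_singleton, not_or] at hzn
    obtain ⟨s, t, hst⟩ := hbas.surj z
    have step : ∃ a' b' : Fin 2 → ZMod 13, ∃ x y : ℕ, x < 7 ∧ y < 7 ∧ a' ∈ B ∧ b' ∈ B ∧ Bas a' b' ∧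
        z = ev a' b' (x, y) ∧ z ≠ a' ∧ z ≠ -a' ∧ z ≠ b' ∧ z ≠ -b' := by
      obtain ⟨z1, z2, z3, z4⟩ := hzn
      obtain ⟨x, hx, hxs⟩ := abs_spec s
      obtain ⟨y, hy, hyt⟩ := abs_spec t
      have na := hS.neg a ha
      have nb := hS.neg b hb
      rcases hxs with rfl | rfl <;> rcases hyt with rfl | rfl
      · exact ⟨a, b, x, y, hx, hy, ha, hb, hbas, hst, z1, z2, z3, z4⟩
      · exact ⟨a, -b, x, y, hx, hy, ha, nb, hbas.negr, by rw [hst, ev]; module, z1, z2, z4,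
          by rwa [neg_neg]⟩
      · exact ⟨-a, b, x, y, hx, hy, na, hb, hbas.negl, by rw [hst, ev]; module, z2,
          by rwa [neg_neg], z3, z4⟩
      · exact ⟨-a, -b, x, y, hx, hy, na, nb, hbas.negl.negr, by rw [hst, ev]; module, z2,
          by rwa [neg_neg], z4, by rwa [neg_neg]⟩
    obtain ⟨a', b', x, y, hx, hy, ha', hb', hbas', rfl, z1, z2, z3, z4⟩ := step
    rcases le_total x y with hxy | hxy
    · exact S13_basis_false hS hbas' ha' hb' hxy hy hz z1 z2 z3 z4
    · have e : ev a' b' (x, y) = ev b' a' (y, x) := by rw [ev, ev, add_comm]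
      rw [e] at hz z1 z2 z3 z4
      exact S13_basis_false hS hbas'.swap hb' ha' hxy hx hz z3 z4 z1 z2
  · push Not at hex
    have : ∃ b : Fin 2 → ZMod 13, ∀ c : ZMod 13, b ≠ c • a := by
      by_contra hcon
      push Not at hcon
      have hsurj : Function.Surjective (fun c : ZMod 13 => c • a) := by
        intro b
        obtain ⟨c, hc⟩ := hcon b
        exact ⟨c, hc.symm⟩
      have := Fintype.card_le_of_surjective _ hsurj
      rw [Fintype.card_fun, ZMod.card, Fintype.card_fin] at this
      norm_num at this
    obtain ⟨b, hbc⟩ := this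
    have hbas := bas_of (nz ha) hbc
    obtain ⟨z, hz, hzn⟩ := exists_new hS.card {a, -a} (Finset.card_le_two.trans (by norm_num))
    simp only [Finset.mem_insert, Finset.mem_singleton, not_or] at hzn
    obtain ⟨c, rfl⟩ := hex z hz
    obtain ⟨r1, r2, r3, r4, r5⟩ := val13 c
    have hev : ev a b (c.val, 0) = c • a := by simp only [ev, r2]; simp
    have hbad := check0_true c.val r1 (fun h => nz hz (by rw [r3 h, zero_smul]))
      (fun h => hzn.1 (by rw [r4 h, one_smul])) (fun h => hzn.2 (by rw [r5 h, neg_one_smul]))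
    refine badc_false hS hbas ?_ ?_ hbad
    · intro st hst
      simp only [P2, List.mem_cons, List.not_mem_nil, or_false] at hst
      rcases hst with rfl | rfl
      · simp only [ev_10, hev]; exact ⟨ha, hz⟩
      · simp only [ev_10, ev_vneg, hev]; exact ⟨ha, hS.neg _ hz⟩
    · intro s hs
      simp only [L2, List.mem_cons, List.not_mem_nil, or_false] at hs
      rcases hs with rfl | rfl | rfl | rfl
      · rwa [ev_10]
      · rw [ev_12]; exact hS.neg _ ha
      · rwa [hev]
      · rw [ev_vneg, hev]; exact hS.neg _ hz

end

theorem eight_ne : ((8 : ℕ) : ZMod 13) ≠ 0 := by decide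

theorem sixteen_ne : ((16 : ℕ) : ZMod 29) ≠ 0 := by decide


/-- Let `D` be a nontrivial 2-(p^d,k,2) design with point set `V = GF(p)^d`
admitting a flag-transitive, point-primitive automorphism group `G = T ⋊ G₀`, with even
replication number `r`.  If `d` is even and `r ∣ 4(p^{d/2} − 1)` then
`(v,k,r) ∈ {(25,4,16), (16,6,6), (81,6,32)}`. -/
theorem stmt_4 (p d e k r : ℕ) [Fact p.Prime]
    (𝓑 : Finset (Finset (Fin d → ZMod p)))
    (G₀ : Subgroup ((Fin d → ZMod p) ≃ₗ[ZMod p] (Fin d → ZMod p)))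
    (hk : ∀ B ∈ 𝓑, B.card = k)
    (hlam : ∀ x y : Fin d → ZMod p, x ≠ y →
      (𝓑.filter (fun B => x ∈ B ∧ y ∈ B)).card = 2)
    (hr : ∀ x : Fin d → ZMod p, (𝓑.filter (fun B => x ∈ B)).card = r)
    (hk2 : 2 < k) (hkv : k < p ^ d)
    (hinv : ∀ B ∈ 𝓑, ∀ g ∈ G₀, ∀ v : Fin d → ZMod p,
      B.image (fun x => g x + v) ∈ 𝓑)
    (hflag : ∀ B ∈ 𝓑, ∀ C ∈ 𝓑, ∀ x ∈ B, ∀ y ∈ C,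
      ∃ g ∈ G₀, ∃ v : Fin d → ZMod p,
        B.image (fun z => g z + v) = C ∧ g x + v = y)
    (hprim : ∀ W : Submodule (ZMod p) (Fin d → ZMod p),
      (∀ g ∈ G₀, ∀ x ∈ W, g x ∈ W) → W = ⊥ ∨ W = ⊤)
    (hreven : Even r)
    (hd : d = 2 * e) (hdiv : r ∣ 4 * (p ^ e - 1)) :
    (p ^ d = 25 ∧ k = 4 ∧ r = 16) ∨
    (p ^ d = 16 ∧ k = 6 ∧ r = 6) ∨
    (p ^ d = 81 ∧ k = 6 ∧ r = 32) := by
  subst hd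
  have hp : p.Prime := Fact.out
  have hcard : Fintype.card (Fin (2 * e) → ZMod p) = p ^ (2 * e) := by
    rw [Fintype.card_fun, ZMod.card, Fintype.card_fin]
  obtain ⟨c1, c2⟩ := aux_count 𝓑 k r hk hlam hr 0
  have c3 := aux_fisher 𝓑 k r hk hlam hr hk2 (by rw [hcard]; exact hkv)
  rw [hcard] at c1 c2
  rcases aux_params p e k r 𝓑.card hp hk2 hkv c3 c1 c2 hdiv with
    h | h | h | ⟨rfl, rfl, rfl, rfl⟩ | ⟨rfl, rfl, rfl, rfl⟩ | ⟨rfl, rfl, rfl, rfl⟩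
  · exact Or.inl h
  · exact Or.inr (Or.inl h)
  · exact Or.inr (Or.inr h)
  · exact (aux_three 𝓑 G₀ hk hlam hinv hflag).elim
  · obtain ⟨B, hB⟩ := aux_S13 𝓑 G₀ ⟨hk, hlam, hinv, hflag, eight_ne⟩ (hr 0)
    exact (S13_false hB).elim
  · exact (aux_29 𝓑 G₀ ⟨hk, hlam, hinv, hflag, sixteen_ne⟩).elim
end

section
/- Let X ≤ GL_4(3) be a subgroup isomorphic to SL_2(5), acting on the set L of all 2-dimensional GF(3)-subspaces of V = GF(3)^4 (so |L| = 130). Then the X-orbits on L have lengths 30, 30, 20, 20, 10, 5, 5, 5, 5, and the members of the orbit of length 10 form a 2-spread of V, i.e., every nonzero vector of V lies in exactly one subspace belonging to that orbit. -/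
/-- The orbit of a subspace `W` of `V = GF(3)^4` under a group `X` of linear automorphisms. -/
def orbX (X : Subgroup ((Fin 4 → ZMod 3) ≃ₗ[ZMod 3] (Fin 4 → ZMod 3)))
    (W : Submodule (ZMod 3) (Fin 4 → ZMod 3)) :
    Set (Submodule (ZMod 3) (Fin 4 → ZMod 3)) :=
  {W' | ∃ g ∈ X, Submodule.map (LinearEquiv.toLinearMap g) W = W'}

namespace S9

abbrev V := Fin 4 → ZMod 3

/-- Nat-coded linear combination of four vectors coded in base 3. -/
def cmb (a b c d m0 m1 m2 m3 : ℕ) : ℕ :=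
  (a * m0 + b * m1 + c * m2 + d * m3) % 3
  + 3 * ((a * (m0 / 3) + b * (m1 / 3) + c * (m2 / 3) + d * (m3 / 3)) % 3)
  + 9 * ((a * (m0 / 9) + b * (m1 / 9) + c * (m2 / 9) + d * (m3 / 9)) % 3)
  + 27 * ((a * (m0 / 27) + b * (m1 / 27) + c * (m2 / 27) + d * (m3 / 27)) % 3)

/-- The matrix with (coded) columns `m0 m1 m2 m3` applied to the vector with code `x`. -/
def app (m0 m1 m2 m3 x : ℕ) : ℕ := cmb x (x / 3) (x / 9) (x / 27) m0 m1 m2 m3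

def Uc (x : ℕ) : ℕ := app 3 9 27 80 x
def Ng (x : ℕ) : ℕ := cmb 2 0 0 0 x 0 0 0

lemma cmb_lt (a b c d m0 m1 m2 m3 : ℕ) : cmb a b c d m0 m1 m2 m3 < 81 := by
  unfold cmb; omega
lemma app_lt (m0 m1 m2 m3 x : ℕ) : app m0 m1 m2 m3 x < 81 := cmb_lt ..
lemma Uc_lt (x : ℕ) : Uc x < 81 := app_lt ..
lemma Ng_lt (x : ℕ) : Ng x < 81 := cmb_lt ..

/-- The vector with code `n` in the frame `p0 p1 p2 p3`. -/
def E (p0 p1 p2 p3 : V) (n : ℕ) : V :=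
  (n : ZMod 3) • p0 + ((n / 3 : ℕ) : ZMod 3) • p1 + ((n / 9 : ℕ) : ZMod 3) • p2
    + ((n / 27 : ℕ) : ZMod 3) • p3

lemma E_cmb (p0 p1 p2 p3 : V) (a b c d m0 m1 m2 m3 : ℕ) :
    E p0 p1 p2 p3 (cmb a b c d m0 m1 m2 m3) =
      (a : ZMod 3) • E p0 p1 p2 p3 m0 + (b : ZMod 3) • E p0 p1 p2 p3 m1
      + (c : ZMod 3) • E p0 p1 p2 p3 m2 + (d : ZMod 3) • E p0 p1 p2 p3 m3 := by
  have key : ∀ A B C D : ℕ,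
      (((A % 3 + 3 * (B % 3) + 9 * (C % 3) + 27 * (D % 3) : ℕ)) : ZMod 3) = A ∧
      ((((A % 3 + 3 * (B % 3) + 9 * (C % 3) + 27 * (D % 3)) / 3 : ℕ)) : ZMod 3) = B ∧
      ((((A % 3 + 3 * (B % 3) + 9 * (C % 3) + 27 * (D % 3)) / 9 : ℕ)) : ZMod 3) = C ∧
      ((((A % 3 + 3 * (B % 3) + 9 * (C % 3) + 27 * (D % 3)) / 27 : ℕ)) : ZMod 3) = D := by
    intro A B C D
    refine ⟨?_, ?_, ?_, ?_⟩ <;> rw [ZMod.natCast_eq_natCast_iff'] <;> omega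
  obtain ⟨h0, h1, h2, h3⟩ := key (a * m0 + b * m1 + c * m2 + d * m3)
    (a * (m0 / 3) + b * (m1 / 3) + c * (m2 / 3) + d * (m3 / 3))
    (a * (m0 / 9) + b * (m1 / 9) + c * (m2 / 9) + d * (m3 / 9))
    (a * (m0 / 27) + b * (m1 / 27) + c * (m2 / 27) + d * (m3 / 27))
  unfold E cmb
  rw [h0, h1, h2, h3]
  push_cast
  module

lemma E_map (f : V →ₗ[ZMod 3] V) (p0 p1 p2 p3 : V) (n : ℕ) :
    f (E p0 p1 p2 p3 n) = E (f p0) (f p1) (f p2) (f p3) n := by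
  simp [E]

lemma E_app (f : V →ₗ[ZMod 3] V) {p0 p1 p2 p3 : V} {m0 m1 m2 m3 : ℕ}
    (h0 : f p0 = E p0 p1 p2 p3 m0) (h1 : f p1 = E p0 p1 p2 p3 m1)
    (h2 : f p2 = E p0 p1 p2 p3 m2) (h3 : f p3 = E p0 p1 p2 p3 m3) (n : ℕ) :
    f (E p0 p1 p2 p3 n) = E p0 p1 p2 p3 (app m0 m1 m2 m3 n) := by
  rw [E_map, app, E_cmb, h0, h1, h2, h3]; rfl

lemma three_nsmul (x : V) : x + x + x = 0 := by
  have : (3 : ZMod 3) • x = 0 := by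
    rw [show (3 : ZMod 3) = 0 from rfl, zero_smul]
  rw [← this]; module

lemma E_neg (p0 p1 p2 p3 : V) (n : ℕ) : E p0 p1 p2 p3 (Ng n) = - E p0 p1 p2 p3 n := by
  rw [Ng, E_cmb]
  have := three_nsmul (E p0 p1 p2 p3 n)
  rw [← sub_eq_zero, ← this]
  push_cast
  module

lemma E0 (p0 p1 p2 p3 : V) : E p0 p1 p2 p3 0 = 0 := by simp [E]
lemma E1 (p0 p1 p2 p3 : V) : E p0 p1 p2 p3 1 = p0 := by simp [E]
lemma E3 (p0 p1 p2 p3 : V) : E p0 p1 p2 p3 3 = p1 := by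
  simp [E, show (3 : ZMod 3) = 0 from rfl]
lemma E9 (p0 p1 p2 p3 : V) : E p0 p1 p2 p3 9 = p2 := by
  simp [E, show (3 : ZMod 3) = 0 from rfl, show (9 : ZMod 3) = 0 from rfl]
lemma E27 (p0 p1 p2 p3 : V) : E p0 p1 p2 p3 27 = p3 := by
  simp [E, show (3 : ZMod 3) = 0 from rfl, show (9 : ZMod 3) = 0 from rfl,
    show (27 : ZMod 3) = 0 from rfl]
lemma E80 (p0 p1 p2 p3 : V) : E p0 p1 p2 p3 80 = -(p0 + p1 + p2 + p3) := by
  have h : (-1 : ZMod 3) = 2 := rfl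
  simp [E, show (80 : ZMod 3) = -1 from rfl, show (26 : ZMod 3) = -1 from rfl,
    show (8 : ZMod 3) = -1 from rfl, ← h]
  module

lemma inv_code : ∀ n < 81, n ≠ 0 → ∃ m < 81,
    cmb m (m / 3) (m / 9) (m / 27) n (Uc n) (Uc (Uc n)) (Uc (Uc (Uc n))) = 1 := by
  decide +kernel

lemma sub_code : ∀ a < 81, ∀ b < 81, cmb 1 2 0 0 a b 0 0 = 0 → a = b := by
  decide +kernel

lemma z_code : ∀ y < 81, app y (Uc y) (Uc (Uc y)) (Uc (Uc (Uc y))) y = 1 → y = 1 ∨ y = 2 := by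
  decide +kernel

lemma h_code : ∀ y < 81,
    app y (Uc (Uc (Uc (Uc y)))) (Uc (Uc (Uc y))) (Uc (Uc y)) y = 2 →
    ∃ c < 81, c ≠ 0 ∧ app y (Uc (Uc (Uc (Uc y)))) (Uc (Uc (Uc y))) (Uc (Uc y)) c
      = cmb 2 0 1 1 c 0 (Uc (Uc c)) (Uc (Uc (Uc c))) := by
  decide +kernel

def Hc (x : ℕ) : ℕ := app 38 52 58 69 x

def M2 (m0 m1 : ℕ) : ℕ := cmb 1 1 1 2 m0 m1 (Hc m0) (Hc m1)
def M3 (m0 m1 : ℕ) : ℕ := cmb 1 2 2 0 m0 (M2 m0 m1) (Hc m0) 0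

def wchk (m0 m1 m2 m3 : ℕ) : Bool :=
  app m0 m1 m2 m3 m0 == 2 &&
  (app m0 m1 m2 m3 (Uc m0) == Ng (Uc (Uc (Uc (Uc (app m0 m1 m2 m3 80))))) &&
  (app m0 m1 m2 m3 (Uc m1) == Ng (Uc (Uc (Uc (Uc (app m0 m1 m2 m3 1))))) &&
  Hc m0 == Ng (Uc (Uc (app m0 m1 m2 m3 (Uc (Uc (Uc (app m0 m1 m2 m3 9)))))))))

lemma w_code : ∀ m0 < 81, ∀ m1 < 81, wchk m0 m1 (M2 m0 m1) (M3 m0 m1) = true →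
    m0 = 32 ∧ m1 = 49 := by
  decide +kernel

end S9
namespace S9

lemma frame (u : V →ₗ[ZMod 3] V) (v : V) (hv : v ≠ 0)
    (hu : u (u (u (u v))) = -(v + u v + u (u v) + u (u (u v)))) :
    (∀ n, u (E v (u v) (u (u v)) (u (u (u v))) n) = E v (u v) (u (u v)) (u (u (u v))) (Uc n)) ∧
    (∀ a < 81, ∀ b < 81, E v (u v) (u (u v)) (u (u (u v))) a
      = E v (u v) (u (u v)) (u (u (u v))) b → a = b) ∧
    (∀ x, ∃ n < 81, E v (u v) (u (u v)) (u (u (u v))) n = x) := by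
  have hU : ∀ n, u (E v (u v) (u (u v)) (u (u (u v))) n)
      = E v (u v) (u (u v)) (u (u (u v))) (Uc n) := by
    intro n
    refine E_app u ?_ ?_ ?_ ?_ n
    · rw [E3]
    · rw [E9]
    · rw [E27]
    · rw [E80, hu]
  have h0 : ∀ n < 81, E v (u v) (u (u v)) (u (u (u v))) n = 0 → n = 0 := by
    intro n hn h
    by_contra hne
    obtain ⟨m, -, hm⟩ := inv_code n hn hne
    apply hv
    rw [← E1 v (u v) (u (u v)) (u (u (u v))), ← hm, E_cmb]
    simp only [← hU, h, map_zero, smul_zero, add_zero]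
  have hinj : ∀ a < 81, ∀ b < 81, E v (u v) (u (u v)) (u (u (u v))) a
      = E v (u v) (u (u v)) (u (u (u v))) b → a = b := by
    intro a ha b hb hab
    apply sub_code a ha b hb
    apply h0 _ (cmb_lt ..)
    rw [E_cmb, hab, E0, ← three_nsmul (E v (u v) (u (u v)) (u (u (u v))) b)]
    push_cast
    module
  refine ⟨hU, hinj, ?_⟩
  have hb : Function.Bijective
      (fun n : Fin 81 => E v (u v) (u (u v)) (u (u (u v))) (n : ℕ)) := by
    rw [Fintype.bijective_iff_injective_and_card]
    refine ⟨fun a b hab => Fin.ext (hinj a a.2 b b.2 hab), ?_⟩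
    simp [ZMod.card]
  intro x
  obtain ⟨n, hn⟩ := hb.2 x
  exact ⟨n, n.2, hn⟩

lemma normal_form (u h w z : V →ₗ[ZMod 3] V)
    (u5 : ∀ x, u (u (u (u (u x)))) = x) (une : ∃ x, u x ≠ x)
    (zu : ∀ x, z (u x) = u (z x)) (zz : ∀ x, z (z x) = x) (zne : ∃ x, z x ≠ x)
    (hh : ∀ x, h (h x) = z x) (hu : ∀ x, h (u x) = u (u (u (u (h x)))))
    (ww : ∀ x, w (w x) = z x) (wh : ∀ x, w (h x) = z (h (w x)))
    (wuw : ∀ x, w (u (w x)) = z (u (u (u (u (w (u (u (u (u x))))))))))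
    (hw : ∀ x, h (w x) = z (u (u (w (u (u (u (w (u (u x)))))))))) :
    ∃ p0 p1 p2 p3 : V,
      (∀ a < 81, ∀ b < 81, E p0 p1 p2 p3 a = E p0 p1 p2 p3 b → a = b) ∧
      (∀ x, ∃ n < 81, E p0 p1 p2 p3 n = x) ∧
      (∀ n, u (E p0 p1 p2 p3 n) = E p0 p1 p2 p3 (Uc n)) ∧
      (∀ n, w (E p0 p1 p2 p3 n) = E p0 p1 p2 p3 (app 32 49 54 9 n)) := by
  -- `u` satisfies the fifth cyclotomic polynomial
  obtain ⟨x, hx⟩ := une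
  have hv : u x - x ≠ 0 := sub_ne_zero.2 hx
  have hv5 : u (u (u (u (u x - x)))) = -((u x - x) + u (u x - x) + u (u (u x - x))
      + u (u (u (u x - x)))) := by
    simp only [map_sub, u5]; abel
  generalize u x - x = v at hv hv5
  have hu4 : ∀ y, u (u (u (u y))) = -(y + u y + u (u y) + u (u (u y))) := by
    obtain ⟨hU, -, hs⟩ := frame u v hv hv5
    intro y
    obtain ⟨n, -, rfl⟩ := hs y
    simp only [E_map]
    rw [hv5]
    simp only [map_neg, map_add]
    rw [hv5]
    simp only [map_neg, map_add]
    rw [hv5]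
    simp only [map_neg, map_add]
    rw [hv5]
    simp only [E]
    module
  -- `z = -1`
  have hz : ∀ y, z y = -y := by
    obtain ⟨hU, hi, hs⟩ := frame u v hv hv5
    obtain ⟨y, hy, hyz⟩ := hs (z v)
    have hZ : ∀ n, z (E v (u v) (u (u v)) (u (u (u v))) n)
      = E v (u v) (u (u v)) (u (u (u v))) (app y (Uc y) (Uc (Uc y)) (Uc (Uc (Uc y))) n) := by
      intro n
      refine E_app z ?_ ?_ ?_ ?_ n
      · exact hyz.symm
      · rw [← hU, hyz, zu]
      · rw [← hU, ← hU, hyz, zu, zu]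
      · rw [← hU, ← hU, ← hU, hyz, zu, zu, zu]
    have h1 := hZ y
    rw [hyz, zz] at h1
    have h2 := hi _ (app_lt ..) 1 (by norm_num) (h1.symm.trans (E1 ..).symm)
    rcases z_code y hy h2 with rfl | rfl
    · exfalso
      obtain ⟨x, hx⟩ := zne
      apply hx
      rw [E1] at hyz
      obtain ⟨n, -, rfl⟩ := hs x
      rw [E_map]
      simp only [zu, hyz.symm]
    · intro x
      have : z v = - v := by
        rw [← hyz, show (2 : ℕ) = Ng 1 from rfl, E_neg, E1]
      obtain ⟨n, -, rfl⟩ := hs x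
      rw [E_map]
      simp only [zu, this, map_neg, E]
      module
  -- choose a good vector
  obtain ⟨v', hv', hhv⟩ : ∃ v', v' ≠ 0 ∧ h v' = -v' + u (u v') + u (u (u v')) := by
    obtain ⟨hU, hi, hs⟩ := frame u v hv hv5
    obtain ⟨y, hy, hyh⟩ := hs (h v)
    have hH : ∀ n, h (E v (u v) (u (u v)) (u (u (u v))) n)
      = E v (u v) (u (u v)) (u (u (u v)))
        (app y (Uc (Uc (Uc (Uc y)))) (Uc (Uc (Uc y))) (Uc (Uc y)) n) := by
      intro n
      refine E_app h ?_ ?_ ?_ ?_ n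
      · exact hyh.symm
      · rw [← hU, ← hU, ← hU, ← hU, hyh, hu]
      · rw [← hU, ← hU, ← hU, hyh, hu, hu, u5]
      · rw [← hU, ← hU, hyh, hu, hu, hu, u5, u5]
    have h1 := hH y
    rw [hyh, hh, hz] at h1
    have h2 : app y (Uc (Uc (Uc (Uc y)))) (Uc (Uc (Uc y))) (Uc (Uc y)) y = 2 := by
      apply hi _ (app_lt ..) 2 (by norm_num)
      rw [← h1, show (2 : ℕ) = Ng 1 from rfl, E_neg, E1]
    obtain ⟨c, hc, hc0, hcc⟩ := h_code y hy h2
    refine ⟨E v (u v) (u (u v)) (u (u (u v))) c, ?_, ?_⟩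
    · intro h
      apply hc0
      apply hi _ hc 0 (by norm_num)
      rw [h, E0]
    · rw [hH, hcc, E_cmb]
      simp only [← hU]
      rw [← sub_eq_zero, ← three_nsmul (E v (u v) (u (u v)) (u (u (u v))) c)]
      push_cast
      module
  clear hv5 hv x hx
  clear v
  obtain ⟨hU, hi, hs⟩ := frame u v' hv' (hu4 v')
  refine ⟨v', u v', u (u v'), u (u (u v')), hi, hs, hU, ?_⟩
  have e38 : h v' = E v' (u v') (u (u v')) (u (u (u v'))) 38 := by
    rw [hhv, E]
    rw [← sub_eq_zero, ← neg_eq_zero, ← three_nsmul v']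
    simp only [show ((38 : ℕ) : ZMod 3) = 2 from rfl, show ((38 / 3 : ℕ) : ZMod 3) = 0 from rfl,
      show ((38 / 9 : ℕ) : ZMod 3) = 1 from rfl, show ((38 / 27 : ℕ) : ZMod 3) = 1 from rfl]
    module
  have hH : ∀ n, h (E v' (u v') (u (u v')) (u (u (u v'))) n)
      = E v' (u v') (u (u v')) (u (u (u v'))) (Hc n) := by
    intro n
    refine E_app h e38 ?_ ?_ ?_ n
    · rw [hu, e38, hU, hU, hU, hU]; rfl
    · rw [hu, hu, u5, e38, hU, hU, hU]; rfl
    · rw [hu, hu, hu, u5, u5, e38, hU, hU]; rfl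
  obtain ⟨m0, hm0, e0⟩ := hs (w v')
  obtain ⟨m1, hm1, e1⟩ := hs (w (u v'))
  -- the relation `w h = - h w`
  have r1 : -w v' + w (u (u v')) + w (u (u (u v'))) = -h (w v') := by
    rw [← hz (h (w v')), ← wh, hhv]; simp
  have huv : h (u v') = v' - u v' - u (u v') + u (u (u v')) := by
    rw [hu, hhv]
    simp only [map_add, map_neg, u5]
    rw [hu4, ← sub_eq_zero, ← neg_eq_zero, ← neg_eq_zero, ← three_nsmul (u v' + u (u v'))]
    abel
  have r2 : w v' - w (u v') - w (u (u v')) + w (u (u (u v'))) = -h (w (u v')) := by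
    rw [← hz (h (w (u v'))), ← wh, huv]; simp
  have e2 : w (u (u v')) = E v' (u v') (u (u v')) (u (u (u v'))) (M2 m0 m1) := by
    rw [M2, E_cmb, ← hH, ← hH, e0, e1]
    have t1 := three_nsmul (w v')
    have t2 := three_nsmul (w (u v'))
    have t3 := three_nsmul (w (u (u v')))
    have t4 := three_nsmul (h (w (u v')))
    push_cast
    have : (-w v' + w (u (u v')) + w (u (u (u v'))) + h (w v'))
      - (w v' - w (u v') - w (u (u v')) + w (u (u (u v'))) + h (w (u v'))) = 0 := by
      rw [r1, r2]; abel
    rw [← sub_eq_zero]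
    have key : ∀ a b c d e f : V, a + a + a = 0 → b + b + b = 0 → c + c + c = 0 →
        f + f + f = 0 →
        (-a + c + d + e) - (a - b - c + d + f) = 0 →
        c - ((1 : ZMod 3) • a + (1 : ZMod 3) • b + (1 : ZMod 3) • e + (2 : ZMod 3) • f) = 0 := by
      intro a b c d e f ha hb hc hf H
      have : c - ((1 : ZMod 3) • a + (1 : ZMod 3) • b + (1 : ZMod 3) • e + (2 : ZMod 3) • f)
        = (c + c + c) - (a + a + a) - (f + f + f)
          - ((-a + c + d + e) - (a - b - c + d + f)) := by module
      rw [this, ha, hc, hf, H]; simp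
    exact_mod_cast key _ _ _ _ _ _ t1 t2 t3 t4 this
  have e3 : w (u (u (u v'))) = E v' (u v') (u (u v')) (u (u (u v'))) (M3 m0 m1) := by
    rw [M3, E_cmb, ← hH, ← e2, e0]
    rw [← sub_eq_zero, E0]
    have t2 := three_nsmul (w (u (u v')) + h (w v'))
    have : w (u (u (u v'))) = (-w v' + w (u (u v')) + w (u (u (u v')))) +w v' - w (u (u v')) := by
      abel
    rw [this, r1, ← neg_eq_zero, ← t2]
    push_cast
    module
  have hW : ∀ n, w (E v' (u v') (u (u v')) (u (u (u v'))) n)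
      = E v' (u v') (u (u v')) (u (u (u v'))) (app m0 m1 (M2 m0 m1) (M3 m0 m1) n) :=
    E_app w e0.symm e1.symm e2 e3
  have c1 : app m0 m1 (M2 m0 m1) (M3 m0 m1) m0 = 2 := by
    apply hi _ (app_lt ..) 2 (by norm_num)
    rw [← hW, e0, ww, hz, show (2 : ℕ) = Ng 1 from rfl, E_neg, E1]
  have c2 : app m0 m1 (M2 m0 m1) (M3 m0 m1) (Uc m0)
      = Ng (Uc (Uc (Uc (Uc (app m0 m1 (M2 m0 m1) (M3 m0 m1) 80))))) := by
    apply hi _ (app_lt ..) _ (Ng_lt _)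
    rw [← hW, ← hU, e0, wuw, hz, E_neg, ← hU, ← hU, ← hU, ← hU, ← hW, E80, hu4 v']
  have c3 : app m0 m1 (M2 m0 m1) (M3 m0 m1) (Uc m1)
      = Ng (Uc (Uc (Uc (Uc (app m0 m1 (M2 m0 m1) (M3 m0 m1) 1))))) := by
    apply hi _ (app_lt ..) _ (Ng_lt _)
    rw [← hW, ← hU, e1, wuw, hz, E_neg, ← hU, ← hU, ← hU, ← hU, ← hW, E1, u5]
  have c4 : Hc m0 = Ng (Uc (Uc (app m0 m1 (M2 m0 m1) (M3 m0 m1)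
      (Uc (Uc (Uc (app m0 m1 (M2 m0 m1) (M3 m0 m1) 9))))))) := by
    apply hi (Hc m0) (app_lt ..) _ (Ng_lt _)
    rw [E_neg, ← hU, ← hU, ← hW, ← hU, ← hU, ← hU, ← hW, E9, ← hH, e0, hw, hz]
  obtain ⟨rfl, rfl⟩ := w_code m0 hm0 m1 hm1 (by simp [wchk, c1, c2, c3, ← c4])
  exact hW

end S9
namespace S9

def tB1 : List ℕ :=
  [1, 3, 10, 9, 17, 4, 13, 14, 12, 11, 1, 9, 1, 13, 11, 17, 4, 3, 15, 16, 16, 12, 5, 16, 13, 10,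
   15, 10, 14, 5, 1, 3, 12, 9, 13, 14, 14, 15, 13, 13, 11, 5, 9, 17, 4, 4, 17, 1, 10, 10, 12, 4,
   3, 11, 10, 5, 15, 5, 3, 1, 1, 3, 5, 9, 15, 1, 1, 11, 3, 9, 3, 16, 14, 16, 13, 17, 16, 11, 12,
   4, 1, 3, 17, 4, 4, 10, 12, 12, 14, 5, 4, 5, 17, 14, 15, 15, 10, 16, 10, 5, 1, 3, 14, 9, 5,
   11, 4, 15, 17, 12, 1, 3, 11, 9, 16, 1, 3, 9, 11, 16, 4, 12, 5, 17, 13, 4, 5, 14, 15, 13]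

def tB2 : List ℕ :=
  [3, 9, 32, 27, 27, 29, 27, 29, 31, 31, 39, 33, 42, 33, 28, 30, 28, 11, 32, 34, 31, 34, 46, 28,
   30, 29, 35, 35, 35, 45, 15, 45, 32, 35, 35, 34, 27, 27, 29, 32, 29, 38, 28, 35, 38, 46, 34,
   51, 33, 27, 33, 11, 38, 30, 30, 9, 28, 29, 28, 30, 9, 27, 27, 31, 34, 27, 45, 33, 37, 32, 47,
   32, 33, 29, 34, 29, 35, 35, 35, 47, 12, 36, 32, 9, 45, 34, 27, 29, 30, 11, 36, 36, 28, 31,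
   31, 33, 28, 30, 31, 28, 36, 10, 32, 30, 47, 34, 27, 29, 33, 28, 33, 46, 32, 29, 27, 48, 29,
   34, 27, 33, 10, 30, 37, 31, 28, 37, 10, 28, 30, 31]

def tU : List ℕ :=
  [1, 3, 5, 6, 7, 8, 10, 12, 14, 16, 0, 4, 17, 2, 13, 20, 21, 11, 19, 22, 23, 25, 26, 28, 9, 24,
   29, 15, 27, 18, 31, 33, 35, 36, 38, 39, 41, 43, 44, 46, 48, 30, 49, 47, 51, 32, 45, 52, 53,
   54, 34, 50, 55, 57, 59, 37, 40, 56, 42, 58, 61, 63, 64, 65, 66, 68, 70, 72, 60, 62, 69, 74,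
   73, 75, 76, 77, 79, 67, 71, 78, 81, 83, 85, 86, 87, 88, 90, 91, 93, 95, 80, 89, 82, 92, 96,
   84, 97, 98, 99, 94, 101, 103, 105, 106, 107, 108, 109, 102, 104, 100, 111, 113, 110, 114,
   112, 116, 117, 118, 119, 115, 121, 123, 120, 124, 122, 126, 128, 125, 129, 127]

def tW : List ℕ :=
  [2, 4, 0, 3, 1, 9, 11, 13, 15, 5, 16, 6, 18, 7, 19, 8, 10, 21, 12, 14, 24, 17, 27, 26, 20, 29,
   23, 22, 28, 25, 32, 34, 30, 37, 31, 40, 42, 33, 45, 47, 35, 48, 36, 50, 44, 38, 51, 39, 41,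
   55, 43, 46, 56, 58, 57, 49, 52, 54, 53, 59, 62, 63, 60, 61, 67, 69, 71, 64, 72, 65, 73, 66,
   68, 70, 77, 78, 79, 74, 75, 76, 82, 84, 80, 86, 81, 89, 83, 92, 94, 85, 95, 96, 87, 97, 88,
   90, 91, 93, 99, 98, 102, 104, 100, 106, 101, 105, 103, 107, 109, 108, 112, 111, 110, 114,
   113, 116, 115, 118, 117, 119, 122, 123, 120, 121, 124, 127, 126, 125, 129, 128]

def tM : List ℕ :=
  [511, 19173961, 304594944551605335229441, 4731607904558235517441, 77919065562289933516801,
   1765411072719716625, 1209073420589916328304641, 1208999644872620927631361,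
   151157232705161494794241, 303416659336844943034369, 2115620184329449346433031,
   37852865210646526165505, 264452523071486457544711, 20070202793430070861825,
   4740885425343869487105, 9741038296298833444865, 2522015804480815377, 38422601,
   9594621768816610279425, 604472709677504329220097, 9523133880129403551745,
   21251226196770295910401, 774772610138776797345, 76148231892934506643457,
   151135327266941685473281, 4759296070252084855809, 604481644924735322095617,
   38074372506544700916737, 19480050253860247191553, 1484968562617525207201, 14909447,
   673308727149561118793, 75578616471331232813057, 75705734933705952330241,
   7083838517733719285761, 5903535690325199699969, 604758080232691268075521,
   38369245973587536412673, 302526643341783652638721, 37818131268884947279873,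
   18898725367634803034113, 1256149484449098062889121, 18926431547726489715201,
   1208935331253360428974081, 462791915330845957685521, 1291275533228133318929,
   302250478249787735015425, 516524596662563241991, 151263454535610337854465,
   18907930830825862464513, 5312806689968729624577, 25762065, 689465506519034288406601,
   606825246535404067751937, 1210107565283851686118401, 42287777, 153476983322603824381953,
   4791830014796497057, 5260204384364527689, 8070450539764121607, 1838599, 1315051100990079049,
   2900318181635653793, 1211291615106134037496321, 1208963289635014335037441,
   126100790505897991, 64563850548588052487, 75853160267482155976705, 1378931013007969446002761,
   605645808399144437678593, 1346622591217447206985, 5019824734730862002177,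
   11806060885595643723777, 40140151700537548537857, 10035605518617401106433,
   151706059581255982383105, 302268636693133732675585, 151189804919129903728641,
   10625613943042014711809, 903895385423860465937, 117469191, 344732753254500622401609,
   18965561002724184686593, 71705361, 2517990171394934046993, 75632229432370645697537,
   302305262146700361863169, 604610528798100114378753, 75595910223528386904065, 69773473,
   1289206049842173560488209, 760301003753076715159713, 38959596671566837055489,
   37801990438187014569985, 19189230026415577006081, 302240822426624944275457,
   9454028430829702611969, 19038201812910640005121, 605057817587367868892161,
   1513209510498402465, 33056565380568552833031, 76620873, 151127256710859508957185,
   302822903917546412704257, 2453419917290625826977, 37927091287913623193601,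
   4917930829730021649, 76738492518921385574401, 604499947483226444005377,
   1209221044082101989675009, 1008806376660533255, 2693229771679919505481,
   1209518421550575877883905, 9463215879622922338817, 152296338221640710160385,
   4132072642835776536583, 2630102221575946313, 151411456330173203612161,
   9481644538928975841281, 1208944410615736558485505, 36750609, 37789308196082132455425,
   396678784579329578762401, 4874561128747875041281, 604536771095202635980801,
   661131307608484838637841, 22156449, 302379109921590320578561, 4797308632538699300865,
   75571698836748378316801]


def B1 (i : ℕ) : ℕ := tB1.getD i 0
def B2 (i : ℕ) : ℕ := tB2.getD i 0
def sU (i : ℕ) : ℕ := tU.getD i 0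
def sW (i : ℕ) : ℕ := tW.getD i 0
def mk (i : ℕ) : ℕ := tM.getD i 0

def Wc (x : ℕ) : ℕ := app 32 49 54 9 x

def lab (i : ℕ) : ℕ :=
  if i < 30 then 0 else if i < 60 then 1 else if i < 80 then 2 else if i < 100 then 3
  else if i < 110 then 4 else if i < 115 then 5 else if i < 120 then 6 else if i < 125 then 7
  else 8

def rep (k : ℕ) : ℕ := [0, 30, 60, 80, 100, 110, 115, 120, 125].getD k 0

lemma mk_sound : ∀ i < 130, ∀ x < 81, (mk i).testBit x = true →
    ∃ a < 3, ∃ b < 3, cmb a b 0 0 (B1 i) (B2 i) 0 0 = x := by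
  decide +kernel

lemma mk_complete : ∀ i < 130, ∀ a < 3, ∀ b < 3,
    (mk i).testBit (cmb a b 0 0 (B1 i) (B2 i) 0 0) = true := by
  decide +kernel

lemma indep_code : ∀ i < 130, ∀ a < 3, ∀ b < 3,
    cmb a b 0 0 (B1 i) (B2 i) 0 0 = 0 → a = 0 ∧ b = 0 := by
  decide +kernel

lemma B_lt : ∀ i < 130, B1 i < 81 ∧ B2 i < 81 := by
  decide +kernel

lemma U_code : ∀ i < 130, sU i < 130 ∧ lab (sU i) = lab i ∧
    (mk (sU i)).testBit (Uc (B1 i)) = true ∧ (mk (sU i)).testBit (Uc (B2 i)) = true := by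
  decide +kernel

lemma W_code : ∀ i < 130, sW i < 130 ∧ lab (sW i) = lab i ∧
    (mk (sW i)).testBit (Wc (B1 i)) = true ∧ (mk (sW i)).testBit (Wc (B2 i)) = true := by
  decide +kernel

/-- The union of the members of the list `l` (as bit masks) which contain `a`. -/
def star (a : ℕ) (l : List ℕ) : ℕ :=
  l.foldr (fun m acc => bif m.testBit a then m ||| acc else acc) 0

lemma star_code : ∀ a < 81, star a tM = 2 ^ 81 - 1 := by
  decide +kernel

lemma star_sound (a b : ℕ) (l : List ℕ) (h : (star a l).testBit b = true) :
    ∃ m ∈ l, m.testBit a = true ∧ m.testBit b = true := by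
  induction l with
  | nil => simp [star] at h
  | cons m l ih =>
    have e : star a (m :: l) = bif m.testBit a then m ||| star a l else star a l := rfl
    rw [e] at h
    cases ha : m.testBit a with
    | false =>
      rw [ha, cond_false] at h
      obtain ⟨m', h1, h2⟩ := ih h
      exact ⟨m', List.mem_cons_of_mem _ h1, h2⟩
    | true =>
      rw [ha, cond_true, Nat.testBit_lor, Bool.or_eq_true] at h
      rcases h with h | h
      · exact ⟨m, List.mem_cons_self, ha, h⟩
      · obtain ⟨m', h1, h2⟩ := ih h
        exact ⟨m', List.mem_cons_of_mem _ h1, h2⟩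

lemma pair_code (a : ℕ) (ha : a < 81) (b : ℕ) (hb : b < 81) :
    ∃ m ∈ tM, m.testBit a = true ∧ m.testBit b = true := by
  apply star_sound
  rw [star_code a ha, Nat.testBit_two_pow_sub_one]
  simpa using hb

lemma tM_length : tM.length = 130 := by decide +kernel

lemma inj_code : ∀ i < 130, ∀ j < 130,
    (mk j).testBit (B1 i) = true → (mk j).testBit (B2 i) = true → i = j := by
  decide +kernel

lemma reach_code : ∀ i < 130, i = rep (lab i) ∨ ∃ j < i, sU j = i ∨ sW j = i := by
  decide +kernel

lemma rep_code : ∀ k < 9, rep k < 130 ∧ lab (rep k) = k := by decide +kernel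

lemma lab_lt (i : ℕ) : lab i < 9 := by unfold lab; split_ifs <;> norm_num

lemma spread_code : ∀ x < 81, x ≠ 0 → ∃ i < 130, lab i = 4 ∧ (mk i).testBit x = true := by
  decide +kernel

lemma spread_code_aux : ∀ i < 130, lab i = 4 → ∀ j < 130, lab j = 4 →
    mk i &&& mk j = 1 ∨ i = j := by
  decide +kernel

lemma spread_code' (x : ℕ) (hx : x ≠ 0) (i : ℕ) (hi : i < 130) (li : lab i = 4)
    (bi : (mk i).testBit x = true) (j : ℕ) (hj : j < 130) (lj : lab j = 4)
    (bj : (mk j).testBit x = true) : i = j := by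
  rcases spread_code_aux i hi li j hj lj with h | h
  · exfalso
    have h1 : (mk i &&& mk j).testBit x = true := by rw [Nat.testBit_land, bi, bj]; rfl
    rw [h, Nat.testBit_one_eq_true_iff_self_eq_zero] at h1
    exact hx h1
  · exact h

lemma count_code : ∀ k : Fin 9, ((Finset.range 130).filter (fun i => lab i = k)).card
    = ![30, 30, 20, 20, 10, 5, 5, 5, 5] k := by
  decide +kernel

end S9
namespace S9

open Matrix

def su : SpecialLinearGroup (Fin 2) (ZMod 5) := ⟨!![1, 1; 0, 1], by decide⟩
def sw : SpecialLinearGroup (Fin 2) (ZMod 5) := ⟨!![0, 1; -1, 0], by decide⟩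
def sh : SpecialLinearGroup (Fin 2) (ZMod 5) := ⟨!![2, 0; 0, 3], by decide⟩
def sz : SpecialLinearGroup (Fin 2) (ZMod 5) := ⟨!![-1, 0; 0, -1], by decide⟩

lemma rel_u5 : su * (su * (su * (su * su))) = 1 := by decide
lemma rel_une : su ≠ 1 := by decide
lemma rel_zne : sz ≠ 1 := by decide
lemma rel_zu : sz * su = su * sz := by decide
lemma rel_zz : sz * sz = 1 := by decide
lemma rel_hh : sh * sh = sz := by decide
lemma rel_hu : sh * su = su * (su * (su * (su * sh))) := by decide
lemma rel_ww : sw * sw = sz := by decide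
lemma rel_wh : sw * sh = sz * (sh * sw) := by decide
lemma rel_wuw : sw * (su * sw) = sz * (su * (su * (su * (su * (sw * (su * (su * (su * su)))))))) := by
  decide
lemma rel_hw : sh * sw = sz * (su * (su * (sw * (su * (su * (su * (sw * (su * su)))))))) := by
  decide

lemma su_pow (n : ℕ) : (su ^ n).1 = !![1, (n : ZMod 5); 0, 1] := by
  induction n with
  | zero => ext i j; fin_cases i <;> fin_cases j <;> simp
  | succ n ih =>
    rw [pow_succ]
    change (su ^ n).1 * su.1 = _
    rw [ih]
    ext i j; fin_cases i <;> fin_cases j <;> simp [su, add_comm]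

lemma sw_cube : (sw ^ 3).1 = !![0, -1; 1, 0] := by
  decide

instance : Fact (Nat.Prime 5) := ⟨by norm_num⟩

lemma gen_aux (s : SpecialLinearGroup (Fin 2) (ZMod 5)) (hc : s.1 1 0 ≠ 0) :
    ∃ i j k : ℕ, s = su ^ i * sw * su ^ j * sw ^ 3 * su ^ k := by
  have hd : s.1 0 0 * s.1 1 1 - s.1 0 1 * s.1 1 0 = 1 := by
    rw [← Matrix.det_fin_two, s.2]
  set a := s.1 0 0 with ha
  set b := s.1 0 1 with hb
  set c := s.1 1 0 with hc'
  set d := s.1 1 1 with hd'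
  refine ⟨((a - 1) / c).val, (-c).val, ((d - 1) / c).val, ?_⟩
  apply Subtype.ext
  change s.1 = (su ^ ((a - 1) / c).val).1 * sw.1 * (su ^ (-c).val).1 * (sw ^ 3).1
    * (su ^ ((d - 1) / c).val).1
  rw [Matrix.eta_fin_two s.1, su_pow, su_pow, su_pow, sw_cube,
    ← ha, ← hb, ← hc', ← hd']
  have hb2 : b = (a * d - 1) / c := by field_simp; linear_combination -hd
  simp only [ZMod.natCast_zmod_val, sw, Matrix.mul_fin_two]
  ext i j
  fin_cases i <;> fin_cases j <;> simp
  · field_simp; ring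
  · rw [hb2]; field_simp; ring
  · field_simp; ring

lemma gen (s : SpecialLinearGroup (Fin 2) (ZMod 5)) : s ∈ Submonoid.closure {su, sw} := by
  have hu : su ∈ Submonoid.closure {su, sw} := Submonoid.subset_closure (by simp)
  have hw : sw ∈ Submonoid.closure {su, sw} := Submonoid.subset_closure (by simp)
  have aux : ∀ s : SpecialLinearGroup (Fin 2) (ZMod 5), s.1 1 0 ≠ 0 →
      s ∈ Submonoid.closure {su, sw} := by
    intro s hs
    obtain ⟨i, j, k, rfl⟩ := gen_aux s hs
    exact mul_mem (mul_mem (mul_mem (mul_mem (pow_mem hu _) hw) (pow_mem hu _)) (pow_mem hw _))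
      (pow_mem hu _)
  by_cases hs : s.1 1 0 = 0
  · have hd : s.1 0 0 * s.1 1 1 - s.1 0 1 * s.1 1 0 = 1 := by
      rw [← Matrix.det_fin_two, s.2]
    have h1 : (s * sw).1 1 0 ≠ 0 := by
      have : (s * sw).1 1 0 = - s.1 1 1 := by
        change (s.1 * sw.1) 1 0 = _
        simp [Matrix.mul_apply, sw]
      rw [this]
      intro h
      rw [neg_eq_zero] at h
      rw [h, hs] at hd
      simp at hd
    have h2 : s = s * sw * sw ^ 3 := by
      rw [mul_assoc, show sw * sw ^ 3 = 1 by decide, mul_one]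
    rw [h2]
    exact mul_mem (aux _ h1) (pow_mem hw _)
  · exact aux s hs

end S9
namespace S9

/-- The `i`-th 2-dimensional subspace of the table, in the frame `F`. -/
def Sb (F : ℕ → V) (i : ℕ) : Submodule (ZMod 3) V := Submodule.span (ZMod 3) {F (B1 i), F (B2 i)}

structure Good (F : ℕ → V) : Prop where
  cm : ∀ a b m n : ℕ, F (cmb a b 0 0 m n 0 0) = (a : ZMod 3) • F m + (b : ZMod 3) • F n
  z : F 0 = 0
  inj : ∀ a < 81, ∀ b < 81, F a = F b → a = b
  surj : ∀ x, ∃ n < 81, F n = x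

lemma mem_Sb {F : ℕ → V} (hF : Good F) {i x : ℕ} (hi : i < 130) (hx : x < 81) :
    F x ∈ Sb F i ↔ (mk i).testBit x = true := by
  rw [Sb, Submodule.mem_span_pair]
  constructor
  · rintro ⟨a, b, h⟩
    have h1 : F (cmb a.val b.val 0 0 (B1 i) (B2 i) 0 0) = F x := by
      rw [hF.cm, ZMod.natCast_zmod_val, ZMod.natCast_zmod_val, h]
    rw [← hF.inj _ (cmb_lt ..) _ hx h1]
    exact mk_complete i hi _ (ZMod.val_lt a) _ (ZMod.val_lt b)
  · intro h
    obtain ⟨a, -, b, -, rfl⟩ := mk_sound i hi x hx h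
    exact ⟨a, b, (hF.cm ..).symm⟩

lemma finrank_Sb {F : ℕ → V} (hF : Good F) {i : ℕ} (hi : i < 130) :
    Module.finrank (ZMod 3) (Sb F i) = 2 := by
  have hl : LinearIndependent (ZMod 3) ![F (B1 i), F (B2 i)] := by
    rw [LinearIndependent.pair_iff]
    intro a b h
    have h1 : F (cmb a.val b.val 0 0 (B1 i) (B2 i) 0 0) = F 0 := by
      rw [hF.cm, ZMod.natCast_zmod_val, ZMod.natCast_zmod_val, h, hF.z]
    have h2 := indep_code i hi _ (ZMod.val_lt a) _ (ZMod.val_lt b)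
      (hF.inj _ (cmb_lt ..) _ (by norm_num) h1)
    exact ⟨(ZMod.val_eq_zero a).1 h2.1, (ZMod.val_eq_zero b).1 h2.2⟩
  have := finrank_span_eq_card hl
  rw [Matrix.range_cons_cons_empty] at this
  exact this

lemma eq_Sb_of {F : ℕ → V} (hF : Good F) {i : ℕ} (hi : i < 130) {W : Submodule (ZMod 3) V}
    (hW : Module.finrank (ZMod 3) W = 2) (h : W ≤ Sb F i) : W = Sb F i :=
  Submodule.eq_of_le_of_finrank_eq h (by rw [hW, finrank_Sb hF hi])

lemma exists_Sb {F : ℕ → V} (hF : Good F) {W : Submodule (ZMod 3) V}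
    (hW : Module.finrank (ZMod 3) W = 2) : ∃ i < 130, W = Sb F i := by
  let b := Module.finBasisOfFinrankEq (ZMod 3) W hW
  obtain ⟨x, hx, hx'⟩ := hF.surj (b 0)
  obtain ⟨y, hy, hy'⟩ := hF.surj (b 1)
  have hp := pair_code x hx y hy
  obtain ⟨m, hm, hp⟩ := hp
  obtain ⟨i, hi, him⟩ := List.getElem_of_mem hm
  have hi' : i < 130 := by rw [← tM_length]; exact hi
  have hmk : mk i = m := (List.getD_eq_getElem _ _ hi).trans him
  rw [← hmk] at hp
  refine ⟨i, hi', eq_Sb_of hF hi' hW ?_⟩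
  intro v hv
  have h := b.sum_repr ⟨v, hv⟩
  rw [Fin.sum_univ_two] at h
  have h2 := congrArg Subtype.val h
  simp only [Submodule.coe_add, Submodule.coe_smul] at h2
  rw [← h2, ← hx', ← hy']
  exact add_mem (Submodule.smul_mem _ _ ((mem_Sb hF hi' hx).2 hp.1))
    (Submodule.smul_mem _ _ ((mem_Sb hF hi' hy).2 hp.2))

lemma inj_Sb {F : ℕ → V} (hF : Good F) {i j : ℕ} (hi : i < 130) (hj : j < 130)
    (h : Sb F i = Sb F j) : i = j := by
  apply inj_code i hi j hj
  · rw [← mem_Sb hF hj (B_lt i hi).1, ← h]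
    exact Submodule.subset_span (by simp)
  · rw [← mem_Sb hF hj (B_lt i hi).2, ← h]
    exact Submodule.subset_span (by simp)

lemma map_Sb {F : ℕ → V} (hF : Good F) (g : V ≃ₗ[ZMod 3] V) (c s : ℕ → ℕ)
    (hc : ∀ n, c n < 81) (hg : ∀ n, g (F n) = F (c n))
    (hs : ∀ i < 130, s i < 130 ∧ lab (s i) = lab i ∧
      (mk (s i)).testBit (c (B1 i)) = true ∧ (mk (s i)).testBit (c (B2 i)) = true)
    {i : ℕ} (hi : i < 130) : Submodule.map (LinearEquiv.toLinearMap g) (Sb F i) = Sb F (s i) := by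
  obtain ⟨h1, -, h2, h3⟩ := hs i hi
  apply eq_Sb_of hF h1
  · rw [LinearEquiv.finrank_map_eq, finrank_Sb hF hi]
  · rw [Sb, Submodule.map_span, Submodule.span_le]
    rintro _ ⟨x, hx, rfl⟩
    rcases hx with rfl | rfl
    · change g (F (B1 i)) ∈ Sb F (s i)
      rw [hg, mem_Sb hF h1 (hc _)]; exact h2
    · change g (F (B2 i)) ∈ Sb F (s i)
      rw [hg, mem_Sb hF h1 (hc _)]; exact h3

lemma map_mul' (g g' : V ≃ₗ[ZMod 3] V) (W : Submodule (ZMod 3) V) :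
    Submodule.map (LinearEquiv.toLinearMap (g * g')) W =
    Submodule.map (LinearEquiv.toLinearMap g) (Submodule.map (LinearEquiv.toLinearMap g') W) := by
  rw [← Submodule.map_comp]; rfl

lemma map_one' (W : Submodule (ZMod 3) V) :
    Submodule.map (LinearEquiv.toLinearMap (1 : V ≃ₗ[ZMod 3] V)) W = W :=
  Submodule.map_id W

end S9

theorem stmt_9 (X : Subgroup ((Fin 4 → ZMod 3) ≃ₗ[ZMod 3] (Fin 4 → ZMod 3)))
    (hX : Nonempty (↥X ≃* Matrix.SpecialLinearGroup (Fin 2) (ZMod 5))) :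
    {W : Submodule (ZMod 3) (Fin 4 → ZMod 3) | Module.finrank (ZMod 3) W = 2}.ncard = 130 ∧
    ∃ Ws : Fin 9 → Submodule (ZMod 3) (Fin 4 → ZMod 3),
      (∀ i, Module.finrank (ZMod 3) (Ws i) = 2) ∧
      (∀ i j, i ≠ j → orbX X (Ws i) ∩ orbX X (Ws j) = ∅) ∧
      (∀ W : Submodule (ZMod 3) (Fin 4 → ZMod 3),
        Module.finrank (ZMod 3) W = 2 → ∃ i, W ∈ orbX X (Ws i)) ∧
      (∀ i, (orbX X (Ws i)).ncard = ![30, 30, 20, 20, 10, 5, 5, 5, 5] i) ∧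
      (∀ x : Fin 4 → ZMod 3, x ≠ 0 → ∃! W, W ∈ orbX X (Ws 4) ∧ x ∈ W) := by
  obtain ⟨e⟩ := hX
  let φ : Matrix.SpecialLinearGroup (Fin 2) (ZMod 5) →*
      ((Fin 4 → ZMod 3) ≃ₗ[ZMod 3] (Fin 4 → ZMod 3)) :=
    X.subtype.comp e.symm.toMonoidHom
  have φX : ∀ s, φ s ∈ X := fun s => (e.symm s).2
  have φs : ∀ g ∈ X, ∃ s, φ s = g := fun g hg => ⟨e ⟨g, hg⟩, by simp [φ]⟩
  have φi : Function.Injective φ := Subtype.val_injective.comp e.symm.injective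
  have φm : ∀ s t x, φ s (φ t x) = φ (s * t) x := fun s t x => by rw [map_mul]; rfl
  have φne : ∀ s, s ≠ 1 → ∃ x, φ s x ≠ x := by
    intro s hs
    by_contra! h
    apply hs
    apply φi
    rw [map_one]
    exact LinearEquiv.ext h
  obtain ⟨p0, p1, p2, p3, hi, hs, hU, hW⟩ := S9.normal_form
    (φ S9.su : (Fin 4 → ZMod 3) ≃ₗ[ZMod 3] (Fin 4 → ZMod 3)).toLinearMap
    (φ S9.sh : (Fin 4 → ZMod 3) ≃ₗ[ZMod 3] (Fin 4 → ZMod 3)).toLinearMap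
    (φ S9.sw : (Fin 4 → ZMod 3) ≃ₗ[ZMod 3] (Fin 4 → ZMod 3)).toLinearMap
    (φ S9.sz : (Fin 4 → ZMod 3) ≃ₗ[ZMod 3] (Fin 4 → ZMod 3)).toLinearMap
    (by intro x; simp only [LinearEquiv.coe_coe, φm, S9.rel_u5, map_one]; rfl)
    (φne _ S9.rel_une)
    (by intro x; simp only [LinearEquiv.coe_coe, φm, S9.rel_zu])
    (by intro x; simp only [LinearEquiv.coe_coe, φm, S9.rel_zz, map_one]; rfl)
    (φne _ S9.rel_zne)
    (by intro x; simp only [LinearEquiv.coe_coe, φm, S9.rel_hh])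
    (by intro x; simp only [LinearEquiv.coe_coe, φm, S9.rel_hu])
    (by intro x; simp only [LinearEquiv.coe_coe, φm, S9.rel_ww])
    (by intro x; simp only [LinearEquiv.coe_coe, φm]; rw [S9.rel_wh])
    (by intro x; simp only [LinearEquiv.coe_coe, φm]; rw [S9.rel_wuw])
    (by intro x; simp only [LinearEquiv.coe_coe, φm]; rw [S9.rel_hw])
  have hF : S9.Good (S9.E p0 p1 p2 p3) :=
    ⟨fun a b m n => by rw [S9.E_cmb]; simp, S9.E0 .., hi, hs⟩
  generalize S9.E p0 p1 p2 p3 = F at hi hs hU hW hF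
  -- the generators permute the table
  have mU : ∀ i < 130, Submodule.map (φ S9.su).toLinearMap (S9.Sb F i) = S9.Sb F (S9.sU i) :=
    fun i h => S9.map_Sb hF (φ S9.su) S9.Uc S9.sU S9.Uc_lt hU S9.U_code h
  have mW : ∀ i < 130, Submodule.map (φ S9.sw).toLinearMap (S9.Sb F i) = S9.Sb F (S9.sW i) :=
    fun i h => S9.map_Sb hF (φ S9.sw) S9.Wc S9.sW (fun _ => S9.app_lt ..) hW S9.W_code h
  have pres : ∀ s, ∀ i < 130, ∃ j < 130, S9.lab j = S9.lab i ∧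
      Submodule.map (φ s).toLinearMap (S9.Sb F i) = S9.Sb F j := by
    intro s
    induction S9.gen s using Submonoid.closure_induction with
    | mem x hx =>
      intro i h
      rcases hx with rfl | rfl
      · exact ⟨_, (S9.U_code i h).1, (S9.U_code i h).2.1, mU i h⟩
      · exact ⟨_, (S9.W_code i h).1, (S9.W_code i h).2.1, mW i h⟩
    | one => exact fun i h => ⟨i, h, rfl, by rw [map_one, S9.map_one']⟩
    | mul x y _ _ hx hy =>
      intro i h
      obtain ⟨j, hj, lj, ej⟩ := hy i h
      obtain ⟨k, hk, lk, ek⟩ := hx j hj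
      exact ⟨k, hk, lk.trans lj, by rw [map_mul, S9.map_mul', ej, ek]⟩
  have reach : ∀ i, i < 130 → S9.Sb F i ∈ orbX X (S9.Sb F (S9.rep (S9.lab i))) := by
    intro i
    induction i using Nat.strong_induction_on with
    | _ i ih =>
      intro h
      rcases S9.reach_code i h with h1 | ⟨j, hj, h1 | h1⟩
      · rw [← h1]
        exact ⟨1, one_mem X, S9.map_one' _⟩
      · have hj' : j < 130 := hj.trans h
        obtain ⟨g, hg, eg⟩ := ih j hj hj'
        have hl := (S9.U_code j hj').2.1
        rw [h1] at hl
        rw [hl]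
        exact ⟨φ S9.su * g, mul_mem (φX _) hg, by rw [S9.map_mul', eg, mU j hj', h1]⟩
      · have hj' : j < 130 := hj.trans h
        obtain ⟨g, hg, eg⟩ := ih j hj hj'
        have hl := (S9.W_code j hj').2.1
        rw [h1] at hl
        rw [hl]
        exact ⟨φ S9.sw * g, mul_mem (φX _) hg, by rw [S9.map_mul', eg, mW j hj', h1]⟩
  have orb : ∀ k < 9, orbX X (S9.Sb F (S9.rep k))
      = S9.Sb F '' ((Finset.range 130).filter (fun i => S9.lab i = k) : Finset ℕ) := by
    intro k hk
    ext W
    constructor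
    · rintro ⟨g, hg, rfl⟩
      obtain ⟨s, rfl⟩ := φs g hg
      obtain ⟨j, hj, lj, ej⟩ := pres s _ (S9.rep_code k hk).1
      refine ⟨j, ?_, ej.symm⟩
      rw [(S9.rep_code k hk).2] at lj
      simp [hj, lj]
    · rintro ⟨i, h, rfl⟩
      simp only [Finset.coe_filter, Finset.mem_range, Set.mem_ofPred_eq] at h
      have := reach i h.1
      rwa [h.2] at this
  have injS : Set.InjOn (S9.Sb F) (Finset.range 130 : Finset ℕ) := by
    intro i h1 j h2 h
    exact S9.inj_Sb hF (by simpa using h1) (by simpa using h2) h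
  refine ⟨?_, fun k => S9.Sb F (S9.rep k), ?_, ?_, ?_, ?_, ?_⟩
  · have : {W : Submodule (ZMod 3) (Fin 4 → ZMod 3) | Module.finrank (ZMod 3) W = 2}
        = S9.Sb F '' (Finset.range 130 : Finset ℕ) := by
      ext W
      constructor
      · intro h
        obtain ⟨i, h1, rfl⟩ := S9.exists_Sb hF h
        exact ⟨i, by simpa using h1, rfl⟩
      · rintro ⟨i, h1, rfl⟩
        exact S9.finrank_Sb hF (by simpa using h1)
    rw [this, injS.ncard_image, Set.ncard_coe_finset, Finset.card_range]
  · exact fun k => S9.finrank_Sb hF (S9.rep_code k k.2).1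
  · intro k l hkl
    simp only [orb _ k.2, orb _ l.2]
    rw [Set.eq_empty_iff_forall_notMem]
    rintro _ ⟨⟨i, h1, rfl⟩, ⟨j, h2, h3⟩⟩
    simp only [Finset.coe_filter, Finset.mem_range, Set.mem_ofPred_eq] at h1 h2
    have := S9.inj_Sb hF h2.1 h1.1 h3
    subst this
    exact hkl (Fin.ext (h1.2.symm.trans h2.2))
  · intro W h
    obtain ⟨i, h1, rfl⟩ := S9.exists_Sb hF h
    exact ⟨⟨S9.lab i, S9.lab_lt i⟩, reach i h1⟩
  · intro k
    simp only [orb _ k.2]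
    rw [Set.InjOn.ncard_image, Set.ncard_coe_finset]
    · exact S9.count_code k
    · exact injS.mono (by intro i; simp +contextual)
  · intro x hx
    obtain ⟨n, hn, rfl⟩ := hF.surj x
    have hn0 : n ≠ 0 := by
      rintro rfl
      exact hx hF.z
    have h4 : orbX X (S9.Sb F (S9.rep ((4 : Fin 9) : ℕ))) = _ := orb 4 (by norm_num)
    simp only [h4]
    obtain ⟨i, h1, l1, b1⟩ := S9.spread_code n hn hn0
    refine ⟨S9.Sb F i, ⟨⟨i, by simp [h1, l1], rfl⟩, (S9.mem_Sb hF h1 hn).2 b1⟩, ?_⟩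
    rintro _ ⟨⟨j, h2, rfl⟩, h3⟩
    simp only [Finset.coe_filter, Finset.mem_range, Set.mem_ofPred_eq] at h2
    rw [S9.mem_Sb hF h2.1 hn] at h3
    rw [S9.spread_code' n hn0 i h1 l1 b1 j h2.1 h2.2 h3]
end
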